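/- arXiv:math/0103180 — 2 statements merged into one kernel-verified Lean document; each statement's English description precedes it below -/
import Mathlib

section
/- Let f : ℝ → ℝ be C¹ and g : ℝ → ℝ be C³ on an interval [a,b] containing 0, with f(0) = g(0) = 0 and g'(0) > 0, and suppose the origin is a center of x'' + f(x)x' + g(x) = 0 with period function T. Then lim_{c→0⁺} (T(c) − 2π/√(g'(0)))/c² = −(π/(12·√(g'(0)))) · ( (3/2)·g'''(0)/g'(0) − (5/2)·g''(0)²/g'(0)² − f'(0)²/g'(0) ). -/
open Set Real Filter

/-- A (C²) solution of the Liénard equation `x'' + f(x)x' + g(x) = 0`. -/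
def IsLienardSolution (f g : ℝ → ℝ) (u : ℝ → ℝ) : Prop :=
  ContDiff ℝ 2 u ∧ ∀ t, deriv (deriv u) t + f (u t) * deriv u t + g (u t) = 0

/-- Variation of constants estimate for the perturbed harmonic oscillator `y'' + y = -e`. -/
lemma abs_sub_harmonic_le {y w e : ℝ → ℝ} {τ E : ℝ}
    (hy : ∀ t ∈ Icc 0 τ, HasDerivAt y (w t) t)
    (hw : ∀ t ∈ Icc 0 τ, HasDerivAt w (-(y t) - e t) t)
    (he : ∀ t ∈ Icc 0 τ, |e t| ≤ E) :
    ∀ t ∈ Icc 0 τ, |y t - (y 0 * cos t + w 0 * sin t)| ≤ 2 * E * τ ∧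
      |w t - (w 0 * cos t - y 0 * sin t)| ≤ 2 * E * τ := by
  intro t ht
  have h0 : (0 : ℝ) ∈ Icc 0 τ := ⟨le_rfl, ht.1.trans ht.2⟩
  have hE : 0 ≤ E := (abs_nonneg _).trans (he 0 h0)
  have hp : ∀ s ∈ Icc 0 τ, HasDerivWithinAt (fun s => y s * cos s - w s * sin s)
      (e s * sin s) (Icc 0 τ) s := fun s hs => by
    have := ((hy s hs).mul (hasDerivAt_cos s)).sub ((hw s hs).mul (hasDerivAt_sin s))
    exact (this.congr_deriv (by ring)).hasDerivWithinAt
  have hq : ∀ s ∈ Icc 0 τ, HasDerivWithinAt (fun s => y s * sin s + w s * cos s)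
      (-(e s * cos s)) (Icc 0 τ) s := fun s hs => by
    have := ((hy s hs).mul (hasDerivAt_sin s)).add ((hw s hs).mul (hasDerivAt_cos s))
    exact (this.congr_deriv (by ring)).hasDerivWithinAt
  have bp := (convex_Icc 0 τ).norm_image_sub_le_of_norm_hasDerivWithin_le hp (C := E)
    (fun s hs => by
      rw [norm_eq_abs, abs_mul]
      exact (mul_le_of_le_one_right (abs_nonneg _) (abs_sin_le_one s)).trans (he s hs)) h0 ht
  have bq := (convex_Icc 0 τ).norm_image_sub_le_of_norm_hasDerivWithin_le hq (C := E)
    (fun s hs => by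
      rw [norm_eq_abs, abs_neg, abs_mul]
      exact (mul_le_of_le_one_right (abs_nonneg _) (abs_cos_le_one s)).trans (he s hs)) h0 ht
  simp only [norm_eq_abs, cos_zero, sin_zero, mul_one, mul_zero, sub_zero, zero_add] at bp bq
  rw [abs_of_nonneg ht.1] at bp bq
  have hEt : E * t ≤ E * τ := mul_le_mul_of_nonneg_left ht.2 hE
  set P := y t * cos t - w t * sin t - y 0
  set Q := y t * sin t + w t * cos t - w 0
  have key : ∀ a b : ℝ, |a| ≤ 1 → |b| ≤ 1 → |P * a + Q * b| ≤ 2 * E * τ := by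
    intro a b ha hb
    have h1 := mul_le_of_le_one_right (abs_nonneg P) ha
    have h2 := mul_le_of_le_one_right (abs_nonneg Q) hb
    have := abs_add_le (P * a) (Q * b)
    rw [abs_mul, abs_mul] at this
    linarith
  have hcs := sin_sq_add_cos_sq t
  constructor
  · convert key (cos t) (sin t) (abs_cos_le_one t) (abs_sin_le_one t) using 2
    simp only [P, Q]
    linear_combination (-y t) * hcs
  · convert key (-sin t) (cos t) (by rw [abs_neg]; exact abs_sin_le_one t)
      (abs_cos_le_one t) using 2
    simp only [P, Q]
    linear_combination (-w t) * hcs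

/-- If the perturbation is small relative to the size of the solution, the solution starting at
rest from `A` stays close to `A * cos`. -/
lemma abs_sub_cos_le {y w e : ℝ → ℝ} {τ ε A : ℝ} (hτ : τ ≤ 8) (hε : ε ≤ 1 / 1000) (hA : 0 ≤ A)
    (hy : ∀ t ∈ Icc 0 τ, HasDerivAt y (w t) t)
    (hw : ∀ t ∈ Icc 0 τ, HasDerivAt w (-(y t) - e t) t)
    (he : ∀ t ∈ Icc 0 τ, |e t| ≤ ε * (|y t| + |w t|)) (hy0 : y 0 = A) (hw0 : w 0 = 0) :
    ∀ t ∈ Icc 0 τ, |y t - A * cos t| ≤ A / 20 ∧ |w t + A * sin t| ≤ A / 20 := by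
  intro t ht
  have hτ0 : 0 ≤ τ := ht.1.trans ht.2
  have hcont : ContinuousOn (fun s => |y s| + |w s|) (Icc 0 τ) := fun s hs =>
    ((hy s hs).continuousAt.abs.add (hw s hs).continuousAt.abs).continuousWithinAt
  obtain ⟨m, hm, hmax⟩ := isCompact_Icc.exists_isMaxOn ⟨t, ht⟩ hcont
  set M := |y m| + |w m| with hM
  have hM0 : 0 ≤ M := by positivity
  have hb : ∀ s ∈ Icc 0 τ, |y s| + |w s| ≤ M := fun s hs => hmax hs
  have hE : ∀ s ∈ Icc 0 τ, |e s| ≤ 1 / 1000 * M := fun s hs =>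
    (he s hs).trans (mul_le_mul hε (hb s hs) (by positivity) (by norm_num))
  have hd := abs_sub_harmonic_le hy hw hE
  have hbound : 2 * (1 / 1000 * M) * τ ≤ 16 / 1000 * M := by nlinarith
  simp only [hy0, hw0, zero_mul, add_zero, zero_sub, sub_neg_eq_add] at hd
  have h1 : |y m| ≤ A + 16 / 1000 * M := by
    have h := (hd m hm).1
    have h2 : |A * cos m| ≤ A := by
      rw [abs_mul, abs_of_nonneg hA]; exact mul_le_of_le_one_right hA (abs_cos_le_one m)
    have := abs_sub_abs_le_abs_sub (y m) (A * cos m)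
    linarith
  have h2 : |w m| ≤ A + 16 / 1000 * M := by
    have h := (hd m hm).2
    have h2 : |A * sin m| ≤ A := by
      rw [abs_mul, abs_of_nonneg hA]; exact mul_le_of_le_one_right hA (abs_sin_le_one m)
    have := abs_sub_abs_le_abs_sub (w m) (-(A * sin m))
    rw [abs_neg, sub_neg_eq_add] at this
    linarith
  have hMA : M ≤ 3 * A := by linarith
  exact ⟨(hd t ht).1.trans (by linarith), (hd t ht).2.trans (by linarith)⟩

/-- `(u, v)` solves the first order system of `u'' + u + F(u) u' + G(u) = 0`. -/
def IsFlow (F G u v : ℝ → ℝ) : Prop :=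
  ∀ t, HasDerivAt u (v t) t ∧ HasDerivAt v (-(u t) - (F (u t) * v t + G (u t))) t

/-- Local Lipschitz control of a damping `F` and a force `G` that vanish at the origin to first
and second order. -/
structure SmallTerms (F G : ℝ → ℝ) (K r : ℝ) : Prop where
  F_zero : F 0 = 0
  G_zero : G 0 = 0
  K_nonneg : 0 ≤ K
  F_lip : ∀ x y, |x| ≤ r → |y| ≤ r → |F x - F y| ≤ K * |x - y|
  G_lip : ∀ x y, |x| ≤ r → |y| ≤ r → |G x - G y| ≤ K * (|x| + |y|) * |x - y|

/-- Amplitudes for which the perturbation is negligible. -/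
structure SmallAmp (K r c : ℝ) : Prop where
  nonneg : 0 ≤ c
  le_r : 3 * c ≤ r
  K_le : 6 * K * c ≤ 1 / 1000

lemma SmallAmp.mono {K r c d : ℝ} (hd : SmallAmp K r d) (hK : 0 ≤ K) (hc : 0 ≤ c) (h : c ≤ d) :
    SmallAmp K r c :=
  ⟨hc, by linarith [hd.le_r], (mul_le_mul_of_nonneg_left h (by positivity)).trans hd.K_le⟩

lemma SmallTerms.abs_F_le {F G : ℝ → ℝ} {K r : ℝ} (h : SmallTerms F G K r) {x : ℝ}
    (hx : |x| ≤ r) : |F x| ≤ K * |x| := by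
  simpa [h.F_zero] using h.F_lip x 0 hx (by simpa using (abs_nonneg x).trans hx)

lemma SmallTerms.abs_G_le {F G : ℝ → ℝ} {K r : ℝ} (h : SmallTerms F G K r) {x : ℝ}
    (hx : |x| ≤ r) : |G x| ≤ K * |x| * |x| := by
  simpa [h.G_zero] using h.G_lip x 0 hx (by simpa using (abs_nonneg x).trans hx)

lemma SmallTerms.abs_perturbation_le {F G : ℝ → ℝ} {K r c : ℝ} (h : SmallTerms F G K r)
    (hc : SmallAmp K r c) {x : ℝ} (hx : |x| ≤ 3 * c) (y : ℝ) :
    |F x * y + G x| ≤ 1 / 1000 * (|x| + |y|) := by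
  have hxr := hx.trans hc.le_r
  have h1 := h.abs_F_le hxr
  have h2 := h.abs_G_le hxr
  have h3 : K * |x| ≤ 1 / 1000 := by
    have := mul_le_mul_of_nonneg_left hx h.K_nonneg
    have := mul_nonneg h.K_nonneg hc.nonneg
    linarith [hc.K_le]
  have h4 : |F x * y| ≤ 1 / 1000 * |y| := by
    rw [abs_mul]; exact mul_le_mul_of_nonneg_right (h1.trans h3) (abs_nonneg _)
  have h5 : K * |x| * |x| ≤ 1 / 1000 * |x| := mul_le_mul_of_nonneg_right h3 (abs_nonneg _)
  have := abs_add_le (F x * y) (G x)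
  linarith

lemma SmallTerms.neg {F G : ℝ → ℝ} {K r : ℝ} (h : SmallTerms F G K r) :
    SmallTerms (fun x => -F x) G K r :=
  ⟨by simp [h.F_zero], h.G_zero, h.K_nonneg, fun x y hx hy => by
    rw [neg_sub_neg, abs_sub_comm]; exact h.F_lip x y hx hy, h.G_lip⟩

lemma IsFlow.reverse {F G u v : ℝ → ℝ} (h : IsFlow F G u v) :
    IsFlow (fun x => -F x) G (fun t => u (-t)) (fun t => -v (-t)) := by
  intro t
  have h1 := (h (-t)).1.comp t (hasDerivAt_neg t)
  have h2 := ((h (-t)).2.comp t (hasDerivAt_neg t)).neg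
  exact ⟨h1.congr_deriv (by ring), h2.congr_deriv (by ring)⟩

lemma IsFlow.shift {F G u v : ℝ → ℝ} (h : IsFlow F G u v) (a : ℝ) :
    IsFlow F G (fun t => u (a + t)) (fun t => v (a + t)) := fun t =>
  ⟨(h (a + t)).1.comp_const_add a t, (h (a + t)).2.comp_const_add a t⟩

lemma seven_pi_div_three_le : 7 * π / 3 ≤ 8 := by linarith [pi_lt_d2]

lemma IsFlow.near_cos {F G u v : ℝ → ℝ} {K r c : ℝ} (h : IsFlow F G u v)
    (hFG : SmallTerms F G K r) (hc : SmallAmp K r c) (hc0 : 0 < c) (hu0 : u 0 = c)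
    (hv0 : v 0 = 0) :
    ∀ t ∈ Icc 0 (7 * π / 3), |u t - c * cos t| ≤ c / 20 ∧ |v t + c * sin t| ≤ c / 20 := by
  have main : ∀ τ ≤ 7 * π / 3, (∀ t ∈ Icc 0 τ, |u t| ≤ 3 * c) → ∀ t ∈ Icc 0 τ,
      |u t - c * cos t| ≤ c / 20 ∧ |v t + c * sin t| ≤ c / 20 := fun τ hτ hb =>
    abs_sub_cos_le (hτ.trans seven_pi_div_three_le) le_rfl hc.nonneg (fun t _ => (h t).1)
      (fun t _ => (h t).2) (fun t ht => hFG.abs_perturbation_le hc (hb t ht) (v t)) hu0 hv0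
  have hcu : Continuous u := continuous_iff_continuousAt.2 fun t => (h t).1.continuousAt
  refine main _ le_rfl ?_
  by_contra! hcon
  obtain ⟨t₂, ht₂, hlt⟩ := hcon
  have hcomp : IsCompact (Icc 0 (7 * π / 3) ∩ {t | 3 * c ≤ |u t|}) :=
    isCompact_Icc.inter_right (isClosed_le continuous_const hcu.abs)
  obtain ⟨τ, ⟨hτ, hτ3⟩, hleast⟩ := hcomp.exists_isLeast ⟨t₂, ht₂, hlt.le⟩
  have hb : ∀ t ∈ Icc 0 τ, |u t| ≤ 3 * c := by
    have hb' : ∀ t ∈ Ico 0 τ, |u t| < 3 * c := fun t ht => by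
      by_contra! hge
      exact absurd (hleast ⟨⟨ht.1, ht.2.le.trans hτ.2⟩, hge⟩) (not_le.2 ht.2)
    have hτ0 : (0 : ℝ) ≠ τ := by
      rintro rfl
      have h3 : 3 * c ≤ |u 0| := hτ3
      rw [hu0, abs_of_pos hc0] at h3
      linarith
    intro t ht
    have hcl : IsClosed {t | |u t| ≤ 3 * c} := isClosed_le hcu.abs continuous_const
    have := closure_minimal (fun t ht => (hb' t ht).le) hcl
    rw [closure_Ico hτ0] at this
    exact this ht
  have h1 := (main τ hτ.2 hb τ ⟨hτ.1, le_rfl⟩).1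
  have h2 : |c * cos τ| ≤ c := by
    rw [abs_mul, abs_of_pos hc0]; exact mul_le_of_le_one_right hc0.le (abs_cos_le_one τ)
  have := abs_sub_abs_le_abs_sub (u τ) (c * cos τ)
  have : 3 * c ≤ |u τ| := hτ3
  linarith

lemma IsFlow.abs_le_two_mul {F G u v : ℝ → ℝ} {K r c : ℝ} (h : IsFlow F G u v)
    (hFG : SmallTerms F G K r) (hc : SmallAmp K r c) (hc0 : 0 < c) (hu0 : u 0 = c)
    (hv0 : v 0 = 0) {t : ℝ} (ht : t ∈ Icc 0 (7 * π / 3)) : |u t| ≤ 2 * c ∧ |v t| ≤ 2 * c := by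
  obtain ⟨h1, h2⟩ := h.near_cos hFG hc hc0 hu0 hv0 t ht
  have h3 : |c * cos t| ≤ c := by
    rw [abs_mul, abs_of_pos hc0]; exact mul_le_of_le_one_right hc0.le (abs_cos_le_one t)
  have h4 : |c * sin t| ≤ c := by
    rw [abs_mul, abs_of_pos hc0]; exact mul_le_of_le_one_right hc0.le (abs_sin_le_one t)
  have := abs_sub_abs_le_abs_sub (u t) (c * cos t)
  have := abs_sub_abs_le_abs_sub (v t) (-(c * sin t))
  rw [abs_neg, sub_neg_eq_add] at this
  constructor <;> linarith

/-- Two solutions starting at rest separate like `(d - c) * cos`. -/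
lemma IsFlow.diff_near_cos {F G u v u₂ v₂ : ℝ → ℝ} {K r c d : ℝ} (h : IsFlow F G u v)
    (h₂ : IsFlow F G u₂ v₂) (hFG : SmallTerms F G K r) (hd : SmallAmp K r d) (hc0 : 0 < c)
    (hcd : c ≤ d) (hu0 : u 0 = c) (hv0 : v 0 = 0) (hu₂0 : u₂ 0 = d) (hv₂0 : v₂ 0 = 0) :
    ∀ t ∈ Icc 0 (7 * π / 3), |u₂ t - u t - (d - c) * cos t| ≤ (d - c) / 20 ∧
      |v₂ t - v t + (d - c) * sin t| ≤ (d - c) / 20 := by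
  have hc := hd.mono hFG.K_nonneg hc0.le hcd
  refine abs_sub_cos_le (y := fun t => u₂ t - u t) (w := fun t => v₂ t - v t)
    (e := fun t => (F (u₂ t) * v₂ t + G (u₂ t)) - (F (u t) * v t + G (u t)))
    seven_pi_div_three_le (le_refl (1 / 1000)) (sub_nonneg.2 hcd)
    (fun t _ => (h₂ t).1.sub (h t).1)
    (fun t _ => ((h₂ t).2.sub (h t).2).congr_deriv (by ring)) ?_ (by simp [hu0, hu₂0])
    (by simp [hv0, hv₂0])
  intro t ht
  obtain ⟨a1, a2⟩ := h.abs_le_two_mul hFG hc hc0 hu0 hv0 ht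
  obtain ⟨b1, b2⟩ := h₂.abs_le_two_mul hFG hd (hc0.trans_le hcd) hu₂0 hv₂0 ht
  have hK := hFG.K_nonneg
  have hr := hd.le_r
  have hr1 : |u t| ≤ r := by linarith
  have hr2 : |u₂ t| ≤ r := by linarith [hd.nonneg]
  have e1 := hFG.abs_F_le hr2
  have e2 := hFG.F_lip _ _ hr2 hr1
  have e3 := hFG.G_lip _ _ hr2 hr1
  set Z := |u₂ t - u t|
  set W := |v₂ t - v t|
  have hZ : 0 ≤ Z := abs_nonneg _
  have hW : 0 ≤ W := abs_nonneg _
  have k1 : |F (u₂ t) * (v₂ t - v t)| ≤ 2 * K * d * W := by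
    rw [abs_mul]
    refine mul_le_mul_of_nonneg_right (e1.trans ?_) hW
    nlinarith
  have k2 : |(F (u₂ t) - F (u t)) * v t| ≤ 2 * K * d * Z := by
    rw [abs_mul]
    calc _ ≤ (K * Z) * (2 * d) :=
          mul_le_mul e2 (by linarith) (abs_nonneg _) (by positivity)
      _ = _ := by ring
  have k3 : |G (u₂ t) - G (u t)| ≤ 4 * K * d * Z := by
    refine e3.trans (mul_le_mul_of_nonneg_right ?_ hZ)
    nlinarith
  have e : F (u₂ t) * v₂ t + G (u₂ t) - (F (u t) * v t + G (u t)) =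
      F (u₂ t) * (v₂ t - v t) + (F (u₂ t) - F (u t)) * v t + (G (u₂ t) - G (u t)) := by ring
  simp only [e]
  have := abs_add_three (F (u₂ t) * (v₂ t - v t)) ((F (u₂ t) - F (u t)) * v t)
    (G (u₂ t) - G (u t))
  have h6 := mul_le_mul_of_nonneg_right hd.K_le hZ
  have h7 := mul_le_mul_of_nonneg_right hd.K_le hW
  have h8 : 0 ≤ K * d * W := by have := hd.nonneg; positivity
  linarith

lemma half_le_cos_of_abs_le {x : ℝ} (hx : |x| ≤ π / 3) : 1 / 2 ≤ cos x := by
  rw [← cos_abs x, ← cos_pi_div_three]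
  exact cos_le_cos_of_nonneg_of_le_pi (abs_nonneg _) (by linarith [pi_pos]) hx

lemma half_le_cos_of_mem_Icc {t : ℝ} (ht : t ∈ Icc (5 * π / 3) (7 * π / 3)) :
    1 / 2 ≤ cos t := by
  rw [← cos_sub_two_pi]
  exact half_le_cos_of_abs_le (abs_le.2 ⟨by linarith [ht.1], by linarith [ht.2]⟩)

lemma cos_le_half_of_mem_Icc {t : ℝ} (ht : t ∈ Icc (π / 3) (5 * π / 3)) : cos t ≤ 1 / 2 := by
  have h : -cos (π / 3) ≤ cos |t - π| := by
    rw [← cos_pi_sub]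
    exact cos_le_cos_of_nonneg_of_le_pi (abs_nonneg _) (by linarith [pi_pos])
      (abs_le.2 ⟨by linarith [ht.1], by linarith [ht.2]⟩)
  rw [cos_abs, cos_sub_pi, cos_pi_div_three] at h
  linarith

lemma IsFlow.strictAntiOn {F G u v : ℝ → ℝ} {K r c a b : ℝ} (h : IsFlow F G u v)
    (hFG : SmallTerms F G K r) (hc : SmallAmp K r c) (hc0 : 0 < c) (hu0 : u 0 = c)
    (hv0 : v 0 = 0) (ha : 0 ≤ a) (hb : b ≤ 7 * π / 3) (hcos : ∀ t ∈ Icc a b, 1 / 2 ≤ cos t) :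
    StrictAntiOn v (Icc a b) := by
  refine strictAntiOn_of_deriv_neg (convex_Icc a b)
    (fun t _ => (h t).2.continuousAt.continuousWithinAt) fun t ht => ?_
  have ht' := interior_subset ht
  have htL : t ∈ Icc 0 (7 * π / 3) := ⟨ha.trans ht'.1, ht'.2.trans hb⟩
  rw [(h t).2.deriv]
  have h1 := (h.near_cos hFG hc hc0 hu0 hv0 t htL).1
  obtain ⟨h2, h3⟩ := h.abs_le_two_mul hFG hc hc0 hu0 hv0 htL
  have h4 := hFG.abs_perturbation_le hc (x := u t) (by linarith) (v t)
  have h5 := mul_le_mul_of_nonneg_left (hcos t ht') hc0.le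
  rw [abs_le] at h1 h4
  linarith [h1.1, h4.1]

lemma IsFlow.exists_return {F G u v : ℝ → ℝ} {K r c : ℝ} (h : IsFlow F G u v)
    (hFG : SmallTerms F G K r) (hc : SmallAmp K r c) (hc0 : 0 < c) (hu0 : u 0 = c)
    (hv0 : v 0 = 0) :
    ∃ t₁ ∈ Icc (5 * π / 3) (7 * π / 3), v t₁ = 0 ∧ 0 < u t₁ ∧ u t₁ ≤ 2 * c ∧
      (∀ t ∈ Ioc 0 (7 * π / 3), v t = 0 → 0 < u t → t = t₁) ∧
      ∀ t ∈ Icc (5 * π / 3) (7 * π / 3), u t ≤ u t₁ := by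
  have hpi := pi_pos
  have near := h.near_cos hFG hc hc0 hu0 hv0
  have hle : 5 * π / 3 ≤ 7 * π / 3 := by linarith
  have hanti := h.strictAntiOn hFG hc hc0 hu0 hv0 (by positivity) le_rfl
    fun t => half_le_cos_of_mem_Icc
  have hanti0 := h.strictAntiOn hFG hc hc0 hu0 hv0 le_rfl (b := π / 3) (by linarith)
    fun t ht => half_le_cos_of_abs_le (abs_le.2 ⟨by linarith [ht.1], ht.2⟩)
  have hsqrt : 1 < √3 := by rw [lt_sqrt] <;> norm_num
  have hva : 0 ≤ v (5 * π / 3) := by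
    have := (near (5 * π / 3) ⟨by positivity, hle⟩).2
    rw [show 5 * π / 3 = 2 * π - π / 3 by ring, sin_two_pi_sub, sin_pi_div_three, abs_le] at this
    rw [show 5 * π / 3 = 2 * π - π / 3 by ring]
    nlinarith [this.1]
  have hvb : v (7 * π / 3) ≤ 0 := by
    have := (near (7 * π / 3) ⟨by positivity, le_rfl⟩).2
    rw [show 7 * π / 3 = π / 3 + 2 * π by ring, sin_add_two_pi, sin_pi_div_three, abs_le] at this
    rw [show 7 * π / 3 = π / 3 + 2 * π by ring]
    nlinarith [this.2]
  have hcv : ContinuousOn v (Icc (5 * π / 3) (7 * π / 3)) := fun t _ =>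
    (h t).2.continuousAt.continuousWithinAt
  obtain ⟨t₁, ht₁, hv₁⟩ := intermediate_value_Icc' hle hcv ⟨hvb, hva⟩
  have ht₁L : t₁ ∈ Icc 0 (7 * π / 3) := ⟨by linarith [ht₁.1], ht₁.2⟩
  have hu₁ := (near t₁ ht₁L).1
  have hcos := mul_le_mul_of_nonneg_left (half_le_cos_of_mem_Icc ht₁) hc0.le
  rw [abs_le] at hu₁
  refine ⟨t₁, ht₁, hv₁, by linarith, ?_, ?_, ?_⟩
  · exact (le_abs_self _).trans (h.abs_le_two_mul hFG hc hc0 hu0 hv0 ht₁L).1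
  · intro t ht hvt hut
    obtain ⟨n1, n2⟩ := near t ⟨ht.1.le, ht.2⟩
    rw [hvt, zero_add, abs_le] at n2
    rw [abs_le] at n1
    have s1 : sin t ≤ 1 / 20 := by nlinarith
    have s2 : -(1 / 20) ≤ sin t := by nlinarith
    have c1 : -(1 / 20) ≤ cos t := by nlinarith
    have c2 : 1 / 2 < cos t := by nlinarith [sin_sq_add_cos_sq t]
    rcases le_total t (π / 3) with hle1 | hge1
    · have := hanti0 ⟨le_rfl, by positivity⟩ ⟨ht.1.le, hle1⟩ ht.1
      linarith
    rcases le_total t (5 * π / 3) with hle2 | hge2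
    · linarith [cos_le_half_of_mem_Icc ⟨hge1, hle2⟩]
    · exact hanti.injOn ⟨hge2, ht.2⟩ ht₁ (hvt.trans hv₁.symm)
  · intro t ht
    rcases le_total t t₁ with hle1 | hge1
    · have : MonotoneOn u (Icc t t₁) := monotoneOn_of_deriv_nonneg (convex_Icc t t₁)
        (fun s _ => (h s).1.continuousAt.continuousWithinAt)
        (fun s _ => (h s).1.differentiableAt.differentiableWithinAt) fun s hs => by
          have hs := interior_subset hs
          rw [(h s).1.deriv, ← hv₁]
          exact hanti.antitoneOn ⟨ht.1.trans hs.1, hs.2.trans ht₁.2⟩ ht₁ hs.2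
      exact this ⟨le_rfl, hle1⟩ ⟨hle1, le_rfl⟩ hle1
    · have : AntitoneOn u (Icc t₁ t) := antitoneOn_of_deriv_nonpos (convex_Icc t₁ t)
        (fun s _ => (h s).1.continuousAt.continuousWithinAt)
        (fun s _ => (h s).1.differentiableAt.differentiableWithinAt) fun s hs => by
          have hs := interior_subset hs
          rw [(h s).1.deriv, ← hv₁]
          exact hanti.antitoneOn ht₁ ⟨ht₁.1.trans hs.1, hs.2.trans ht.2⟩ hs.1
      exact this ⟨le_rfl, hge1⟩ ⟨hge1, le_rfl⟩ hge1

/-- The first return map is strictly increasing. -/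
lemma IsFlow.return_lt {F G u v u₂ v₂ : ℝ → ℝ} {K r c d s s₂ : ℝ} (h : IsFlow F G u v)
    (h₂ : IsFlow F G u₂ v₂) (hFG : SmallTerms F G K r) (hd : SmallAmp K r d) (hc0 : 0 < c)
    (hcd : c < d) (hu0 : u 0 = c) (hv0 : v 0 = 0) (hu₂0 : u₂ 0 = d) (hv₂0 : v₂ 0 = 0)
    (hs : s ∈ Ioc 0 (7 * π / 3)) (hvs : v s = 0) (hus : 0 < u s)
    (hs₂ : s₂ ∈ Ioc 0 (7 * π / 3)) (hvs₂ : v₂ s₂ = 0) (hus₂ : 0 < u₂ s₂) : u s < u₂ s₂ := by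
  have hc := hd.mono hFG.K_nonneg hc0.le hcd.le
  obtain ⟨t, ht, -, -, -, huniq, -⟩ := h.exists_return hFG hc hc0 hu0 hv0
  obtain ⟨t₂, ht₂, -, -, -, huniq₂, hmax₂⟩ := h₂.exists_return hFG hd (hc0.trans hcd) hu₂0 hv₂0
  obtain rfl := huniq s hs hvs hus
  obtain rfl := huniq₂ s₂ hs₂ hvs₂ hus₂
  refine lt_of_lt_of_le ?_ (hmax₂ s ht)
  have h1 := h.diff_near_cos h₂ hFG hd hc0 hcd.le hu0 hv0 hu₂0 hv₂0 s ⟨hs.1.le, hs.2⟩ |>.1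
  have h2 := mul_le_mul_of_nonneg_left (half_le_cos_of_mem_Icc ht) (sub_pos.2 hcd).le
  rw [abs_le] at h1
  linarith

/-- A solution that moves inward at its first return never comes back to its initial state. -/
lemma IsFlow.ne_of_return_lt {F G u v : ℝ → ℝ} {K r c s p : ℝ} (h : IsFlow F G u v)
    (hFG : SmallTerms F G K r) (hc : SmallAmp K r c) (hu0 : u 0 = c)
    (hv0 : v 0 = 0) (hs : s ∈ Ioc 0 (7 * π / 3)) (hvs : v s = 0) (hus : 0 < u s)
    (hlt : u s < c) (hp : 0 < p) (hvp : v p = 0) : u p ≠ c := by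
  have hc0 : 0 < c := hus.trans hlt
  have main : ∀ n : ℕ, ∃ t, (n : ℝ) ≤ t ∧ 0 ≤ t ∧ ∃ s ∈ Ioc 0 (7 * π / 3), v t = 0 ∧ v (t + s) = 0 ∧
      0 < u (t + s) ∧ u (t + s) < u t ∧ u t ≤ c ∧ ∀ q ∈ Ioc 0 t, v q = 0 → 0 < u q → u q < c := by
    intro n
    induction n with
    | zero =>
      exact ⟨0, by simp, le_rfl, s, hs, hv0, by simpa using hvs, by simpa using hus,
        by simpa [hu0] using hlt, hu0.le, fun q hq => absurd hq.1 (not_lt.2 hq.2)⟩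
    | succ n ih =>
      obtain ⟨t, hnt, ht0, s, hs, hvt, hvs, hus, hlt, hut, hq⟩ := ih
      have ht := h.shift t
      have hts := h.shift (t + s)
      have hd := hc.mono hFG.K_nonneg (hus.trans hlt).le hut
      have hd' := hd.mono hFG.K_nonneg hus.le hlt.le
      obtain ⟨t₁, ht₁, -, -, -, huniq, -⟩ := ht.exists_return hFG hd (hus.trans hlt)
        (by simp) (by simpa using hvt)
      obtain ⟨s₂, hs₂, hvs₂, hus₂, -, -, -⟩ := hts.exists_return hFG hd' hus
        (by simp) (by simpa using hvs)
      obtain rfl := huniq s hs hvs hus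
      have hpi := pi_gt_three
      have hs₂' : s₂ ∈ Ioc 0 (7 * π / 3) := ⟨by linarith [hs₂.1], hs₂.2⟩
      refine ⟨t + s, ?_, by linarith [hs.1], s₂, hs₂', hvs, hvs₂, hus₂, ?_, by linarith, ?_⟩
      · push_cast; linarith [ht₁.1]
      · have := hts.return_lt ht hFG hd hus hlt (by simp) (by simpa using hvs) (by simp)
          (by simpa using hvt) hs₂' hvs₂ hus₂ hs hvs hus
        exact this
      · intro q hq' hvq huq
        rcases le_or_gt q t with hqt | hqt
        · exact hq q ⟨hq'.1, hqt⟩ hvq huq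
        · have := huniq (q - t) ⟨by linarith, by linarith [hq'.2, hs.2]⟩ (by simpa using hvq)
            (by simpa using huq)
          rw [← this] at hlt
          simp only [add_sub_cancel] at hlt
          linarith
  obtain ⟨n, hn⟩ := exists_nat_ge p
  obtain ⟨t, hnt, -, -, -, -, -, -, -, -, hq⟩ := main n
  intro hup
  exact (hq p ⟨hp, hn.trans hnt⟩ hvp (hup ▸ hc0)).ne hup

/-- Small periodic solutions close up at their first return. -/
lemma IsFlow.exists_return_eq {F G u v : ℝ → ℝ} {K r c p : ℝ} (h : IsFlow F G u v)
    (hFG : SmallTerms F G K r) (hc : SmallAmp K r (2 * c)) (hc0 : 0 < c) (hu0 : u 0 = c)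
    (hv0 : v 0 = 0) (hp : 0 < p) (hup : Function.Periodic u p) (hvp : Function.Periodic v p) :
    ∃ t₁ ∈ Icc (5 * π / 3) (7 * π / 3), v t₁ = 0 ∧ u t₁ = c ∧
      ∀ t ∈ Ioc 0 (7 * π / 3), v t = 0 → 0 < u t → t = t₁ := by
  have hc' := hc.mono hFG.K_nonneg hc0.le (by linarith)
  obtain ⟨t₁, ht₁, hv₁, hu₁, hle, huniq, -⟩ := h.exists_return hFG hc' hc0 hu0 hv0
  have hpi := pi_pos
  have ht₁' : t₁ ∈ Ioc 0 (7 * π / 3) := ⟨by linarith [ht₁.1], ht₁.2⟩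
  refine ⟨t₁, ht₁, hv₁, ?_, huniq⟩
  rcases lt_trichotomy (u t₁) c with hlt | heq | hgt
  · exact absurd (by simpa [hu0] using hup 0)
      (h.ne_of_return_lt hFG hc' hu0 hv0 ht₁' hv₁ hu₁ hlt hp (by simpa [hv0] using hvp 0))
  · exact heq
  · have hr := h.reverse
    have hr₁ := (h.shift t₁).reverse
    obtain ⟨s, hs, hvs, hus, -, -, -⟩ := hr.exists_return hFG.neg hc' hc0 (by simpa using hu0)
      (by simpa using hv0)
    have hs' : s ∈ Ioc 0 (7 * π / 3) := ⟨by linarith [hs.1], hs.2⟩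
    have hlt := hr.return_lt hr₁ hFG.neg (hc.mono hFG.K_nonneg hu₁.le hle) hc0 hgt
      (by simpa using hu0) (by simpa using hv0) (by simp) (by simpa using hv₁) hs' hvs hus ht₁'
      (by simpa using hv0) (by simpa [hu0] using hc0)
    simp only [add_neg_cancel, hu0] at hlt
    refine absurd ?_ (hr.ne_of_return_lt hFG.neg hc' (by simpa using hu0) (by simpa using hv0) hs'
      hvs hus hlt hp ?_)
    · simpa [hu0] using (hup (-p)).symm
    · simpa [hv0] using (hvp (-p)).symm

/-- A small periodic solution that is back in its initial state after time `s` has period `s`. -/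
lemma IsFlow.periodic_of_return {F G u v : ℝ → ℝ} {K r c s p : ℝ} (h : IsFlow F G u v)
    (hFG : SmallTerms F G K r) (hc : SmallAmp K r c) (hc0 : 0 < c) (hu0 : u 0 = c)
    (hv0 : v 0 = 0) (hs : s ∈ Icc 1 (7 * π / 3)) (hvs : v s = 0) (hus : u s = c)
    (hp : 0 < p) (hup : Function.Periodic u p) : Function.Periodic u s := by
  have step : ∀ a, u a = c → v a = 0 → ∀ t ∈ Icc 0 (7 * π / 3),
      u (a + t) = u t ∧ v (a + t) = v t := by
    intro a hua hva t ht
    have := h.diff_near_cos (h.shift a) hFG hc hc0 le_rfl hu0 hv0 (by simpa using hua)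
      (by simpa using hva) t ht
    simpa [sub_eq_zero] using this
  have hs0 : 0 < s := by linarith [hs.1]
  have hn : ∀ n : ℕ, u (n * s) = c ∧ v (n * s) = 0 := by
    intro n
    induction n with
    | zero => simp [hu0, hv0]
    | succ n ih =>
      obtain ⟨h1, h2⟩ := step _ ih.1 ih.2 s ⟨hs0.le, hs.2⟩
      have e : ((n + 1 : ℕ) : ℝ) * s = n * s + s := by push_cast; ring
      rw [e, h1, h2]
      exact ⟨hus, hvs⟩
  have hpos : ∀ t, 0 ≤ t → u (t + s) = u t := by
    intro t ht
    set n := ⌊t / s⌋₊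
    have h1 : n * s ≤ t := (le_div_iff₀ hs0).1 (Nat.floor_le (by positivity))
    have h2 : t < (n + 1) * s := (div_lt_iff₀ hs0).1 (Nat.lt_floor_add_one _)
    have hq : t - n * s ∈ Icc 0 (7 * π / 3) := ⟨by linarith, by linarith [hs.2]⟩
    have e1 := (step _ (hn n).1 (hn n).2 _ hq).1
    have e2 := (step _ (hn (n + 1)).1 (hn (n + 1)).2 _ hq).1
    rw [add_sub_cancel] at e1
    rw [e1, ← e2]
    congr 1
    push_cast
    ring
  intro t
  obtain ⟨n, hn⟩ := exists_nat_ge (-t / p)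
  have h1 : 0 ≤ t + n * p := by
    rw [div_le_iff₀ hp] at hn
    linarith
  have h2 := hpos _ h1
  have h3 := hup.nat_mul n
  rw [h3, add_right_comm, h3] at h2
  exact h2

lemma abs_mul_le_of_abs_le {a b A B : ℝ} (ha : |a| ≤ A) (hb : |b| ≤ B) : |a * b| ≤ A * B := by
  rw [abs_mul]
  exact mul_le_mul ha hb (abs_nonneg _) ((abs_nonneg _).trans ha)

lemma abs_sub_sin_le {q : ℝ} (hq : |q| ≤ π / 3) :
    |q| ≤ 2 * |sin q| ∧ |q - sin q| ≤ 2 * |sin q| ^ 3 := by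
  have main : ∀ q, 0 ≤ q → q ≤ π / 3 → q ≤ 2 * sin q ∧ |q - sin q| ≤ 2 * sin q ^ 3 := by
    intro q h0 hq
    have hpi := pi_pos
    have h1 := mul_le_sin h0 (by linarith)
    have hs : 0 ≤ sin q := sin_nonneg_of_nonneg_of_le_pi h0 (by linarith)
    have h2 : q ≤ 2 * sin q := by
      have h3 : 1 / 2 ≤ 2 / π := by
        rw [div_le_div_iff₀ (by norm_num) hpi]; linarith [pi_lt_four]
      nlinarith
    refine ⟨h2, ?_⟩
    have hc := half_le_cos_of_abs_le (abs_le.2 ⟨by linarith, hq⟩)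
    have h3 := sin_le h0
    have h4 : q * cos q ≤ sin q := by
      rw [← le_div_iff₀ (by linarith), ← tan_eq_sin_div_cos]
      exact le_tan h0 (by linarith)
    rw [abs_of_nonneg (by linarith)]
    have h5 : 1 - cos q ≤ sin q ^ 2 := by nlinarith [sin_sq_add_cos_sq q, cos_le_one q]
    have h6 := mul_le_mul h2 h5 (by linarith [cos_le_one q]) (by positivity)
    nlinarith
  rcases le_total 0 q with h0 | h0
  · have h := main q h0 ((le_abs_self q).trans hq)
    have hs : 0 ≤ sin q := by linarith
    rwa [abs_of_nonneg h0, abs_of_nonneg hs]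
  · have h := main (-q) (by linarith) ((neg_le_abs q).trans hq)
    rw [sin_neg] at h
    have hs : sin q ≤ 0 := by linarith
    rw [abs_of_nonpos h0, abs_of_nonpos hs, abs_sub_comm, ← neg_sub_neg, neg_sub_neg]
    rwa [sub_neg_eq_add, neg_add_eq_sub] at h

/-- The first order correction to `cos`. -/
noncomputable def firstCorrection (f₁ g₂ t : ℝ) : ℝ :=
  f₁ / 3 * (sin t - sin t * cos t) + g₂ * (-1 / 3 + cos t ^ 2 / 6 + cos t / 6)

/-- The derivative of `firstCorrection`. -/
noncomputable def firstCorrectionDeriv (f₁ g₂ t : ℝ) : ℝ :=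
  f₁ / 3 * (cos t - (cos t ^ 2 - sin t ^ 2)) + g₂ * (-(cos t * sin t) / 3 - sin t / 6)

lemma hasDerivAt_firstCorrection (f₁ g₂ t : ℝ) :
    HasDerivAt (firstCorrection f₁ g₂) (firstCorrectionDeriv f₁ g₂ t) t := by
  have hs := hasDerivAt_sin t
  have hc := hasDerivAt_cos t
  have := ((hs.sub (hs.mul hc)).const_mul (f₁ / 3)).add
    ((((hc.pow 2).div_const 6).const_add (-1 / 3) |>.add (hc.div_const 6)).const_mul g₂)
  refine this.congr_deriv ?_
  simp only [firstCorrectionDeriv]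
  push_cast
  ring

lemma hasDerivAt_firstCorrectionDeriv (f₁ g₂ t : ℝ) :
    HasDerivAt (firstCorrectionDeriv f₁ g₂)
      (-firstCorrection f₁ g₂ t - (-(f₁ * (cos t * sin t)) + g₂ / 2 * cos t ^ 2)) t := by
  have hs := hasDerivAt_sin t
  have hc := hasDerivAt_cos t
  have := ((hc.sub ((hc.pow 2).sub (hs.pow 2))).const_mul (f₁ / 3)).add
    (((hc.mul hs).neg.div_const 3 |>.sub (hs.div_const 6)).const_mul g₂)
  refine this.congr_deriv ?_
  simp only [firstCorrection]
  push_cast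
  linear_combination (g₂ / 3) * sin_sq_add_cos_sq t

lemma abs_firstCorrection_le {f₁ g₂ B : ℝ} (hf : |f₁| ≤ B) (hg : |g₂| ≤ B) (t : ℝ) :
    |firstCorrection f₁ g₂ t| ≤ 2 * B := by
  have hs := abs_sin_le_one t
  have hc := abs_cos_le_one t
  have h1 : |sin t - sin t * cos t| ≤ 2 := by
    have := abs_sub (sin t) (sin t * cos t)
    have := abs_mul_le_of_abs_le hs hc
    linarith
  have h2 : |-1 / 3 + cos t ^ 2 / 6 + cos t / 6| ≤ 1 := by
    rw [abs_le] at hc ⊢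
    constructor <;> nlinarith
  have h3 := abs_mul_le_of_abs_le hf h1
  have h4 := abs_mul_le_of_abs_le hg h2
  have h5 := abs_add_le (f₁ / 3 * (sin t - sin t * cos t))
    (g₂ * (-1 / 3 + cos t ^ 2 / 6 + cos t / 6))
  rw [div_mul_eq_mul_div, abs_div, abs_of_pos (by norm_num : (0 : ℝ) < 3)] at h5
  have : 0 ≤ B := (abs_nonneg _).trans hf
  rw [firstCorrection, div_mul_eq_mul_div]
  linarith

/-- The integrand of the second order period correction. -/
noncomputable def periodIntegrand (f₁ g₂ g₃ t : ℝ) : ℝ :=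
  -(g₂ * cos t ^ 2 * firstCorrection f₁ g₂ t) - g₃ / 6 * cos t ^ 4
    - f₁ * cos t * sin t * firstCorrection f₁ g₂ t

/-- The second order coefficient of the period. -/
noncomputable def periodCoeff (f₁ g₂ g₃ : ℝ) : ℝ :=
  5 * π * g₂ ^ 2 / 24 - π * g₃ / 8 + π * f₁ ^ 2 / 12

/-- An antiderivative of `periodIntegrand`. -/
noncomputable def periodPrimitive (f₁ g₂ g₃ t : ℝ) : ℝ :=
  periodCoeff f₁ g₂ g₃ / (2 * π) * t
    - f₁ * g₂ / 3 * (-(cos t ^ 3) / 3 + cos t ^ 4 / 4)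
    - g₂ ^ 2 * (-(sin t * cos t) / 6 + (3 * (sin t * cos t) / 8 + sin t * cos t ^ 3 / 4) / 6
        + (sin t - sin t ^ 3 / 3) / 6)
    - g₃ / 6 * (3 * (sin t * cos t) / 8 + sin t * cos t ^ 3 / 4)
    - f₁ ^ 2 / 3 * (sin t ^ 3 / 3 - (sin t * cos t / 8 - sin t * cos t ^ 3 / 4))
    - f₁ * g₂ * (cos t ^ 2 / 6 - cos t ^ 4 / 24 - cos t ^ 3 / 18)

lemma hasDerivAt_periodPrimitive (f₁ g₂ g₃ t : ℝ) :
    HasDerivAt (periodPrimitive f₁ g₂ g₃) (periodIntegrand f₁ g₂ g₃ t) t := by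
  have hs := hasDerivAt_sin t
  have hc := hasDerivAt_cos t
  have h1 := hs.mul hc
  have h2 := hs.mul (hc.pow 3)
  have h3 := ((h1.const_mul 3).div_const 8).add (h2.div_const 4)
  have := (((((hasDerivAt_id' t).const_mul (periodCoeff f₁ g₂ g₃ / (2 * π))).sub
    ((((hc.pow 3).neg.div_const 3).add ((hc.pow 4).div_const 4)).const_mul (f₁ * g₂ / 3))).sub
    ((((h1.neg.div_const 6).add (h3.div_const 6)).add
      ((hs.sub ((hs.pow 3).div_const 3)).div_const 6)).const_mul (g₂ ^ 2))).sub
    (h3.const_mul (g₃ / 6))).sub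
    ((((hs.pow 3).div_const 3).sub ((h1.div_const 8).sub (h2.div_const 4))).const_mul
      (f₁ ^ 2 / 3)) |>.sub
    (((((hc.pow 2).div_const 6).sub ((hc.pow 4).div_const 24)).sub
      ((hc.pow 3).div_const 18)).const_mul (f₁ * g₂))
  refine this.congr_deriv ?_
  have hA : periodCoeff f₁ g₂ g₃ / (2 * π) = 5 * g₂ ^ 2 / 48 - g₃ / 16 + f₁ ^ 2 / 24 := by
    rw [periodCoeff]
    field_simp
    ring
  rw [hA, periodIntegrand, firstCorrection]
  have e : sin t ^ 2 = 1 - cos t ^ 2 := by linarith [sin_sq_add_cos_sq t]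
  simp only [Pi.pow_apply]
  push_cast
  ring_nf
  simp only [e]
  ring

lemma periodPrimitive_two_pi_sub (f₁ g₂ g₃ : ℝ) :
    periodPrimitive f₁ g₂ g₃ (2 * π) - periodPrimitive f₁ g₂ g₃ 0 = periodCoeff f₁ g₂ g₃ := by
  simp only [periodPrimitive, cos_two_pi, sin_two_pi, cos_zero, sin_zero]
  field_simp
  ring

lemma abs_periodIntegrand_le {f₁ g₂ g₃ B : ℝ} (hB : 1 ≤ B) (hf : |f₁| ≤ B) (hg : |g₂| ≤ B)
    (hg₃ : |g₃| ≤ B) (t : ℝ) : |periodIntegrand f₁ g₂ g₃ t| ≤ 5 * B ^ 2 := by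
  have hs := abs_sin_le_one t
  have hc := abs_cos_le_one t
  have hv := abs_firstCorrection_le hf hg t
  have hc2 : |cos t ^ 2| ≤ 1 := by rw [abs_pow]; exact pow_le_one₀ (abs_nonneg _) hc
  have hc4 : |cos t ^ 4| ≤ 1 := by rw [abs_pow]; exact pow_le_one₀ (abs_nonneg _) hc
  have h1 := abs_mul_le_of_abs_le (abs_mul_le_of_abs_le hg hc2) hv
  have h2 : |g₃ / 6 * cos t ^ 4| ≤ B / 6 * 1 := by
    refine abs_mul_le_of_abs_le ?_ hc4
    rw [abs_div, abs_of_pos (by norm_num : (0 : ℝ) < 6)]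
    linarith
  have h3 := abs_mul_le_of_abs_le (abs_mul_le_of_abs_le (abs_mul_le_of_abs_le hf hc) hs) hv
  rw [periodIntegrand]
  rw [abs_le] at *
  constructor <;> nlinarith

lemma abs_periodCoeff_le {f₁ g₂ g₃ B : ℝ} (hB : 1 ≤ B) (hf : |f₁| ≤ B) (hg : |g₂| ≤ B)
    (hg₃ : |g₃| ≤ B) : |periodCoeff f₁ g₂ g₃| ≤ 2 * B ^ 2 := by
  have h1 : g₂ ^ 2 ≤ B ^ 2 := by rw [← sq_abs]; gcongr
  have h2 : f₁ ^ 2 ≤ B ^ 2 := by rw [← sq_abs]; gcongr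
  have h3 : |5 * g₂ ^ 2 / 24 - g₃ / 8 + f₁ ^ 2 / 12| ≤ B ^ 2 / 2 := by
    rw [abs_le] at *
    constructor <;> nlinarith
  have h4 := abs_mul_le_of_abs_le (show |π| ≤ 4 by
    rw [abs_of_pos pi_pos]; exact pi_lt_four.le) h3
  rw [periodCoeff]
  convert h4 using 1 <;> [congr 1; skip] <;> ring

/-- A closed orbit of the equation `x'' + x + c (φ(x) x' + γ(x)) = 0` obtained by scaling a
Liénard equation to amplitude one, with `ε`-approximations of `φ` and `γ`. -/
structure ScaledOrbit (f₁ g₂ g₃ B ε c p : ℝ) (φ γ x y : ℝ → ℝ) : Prop where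
  one_le : 1 ≤ B
  f₁_le : |f₁| ≤ B
  g₂_le : |g₂| ≤ B
  g₃_le : |g₃| ≤ B
  ε_nonneg : 0 ≤ ε
  ε_le : ε ≤ 1
  c_pos : 0 < c
  c_le : c ≤ 1
  p_mem : p ∈ Icc (5 * π / 3) (7 * π / 3)
  φ_cont : Continuous φ
  φ_near : ∀ z, |z| ≤ 2 → |φ z - f₁ * z| ≤ ε
  γ_near : ∀ z, |z| ≤ 2 → |γ z - (g₂ * z ^ 2 / 2 + c * (g₃ * z ^ 3 / 6))| ≤ ε * c
  deriv_x : ∀ t ∈ Icc 0 p, HasDerivAt x (y t) t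
  deriv_y : ∀ t ∈ Icc 0 p, HasDerivAt y (-(x t) - c * (φ (x t) * y t + γ (x t))) t
  x_zero : x 0 = 1
  y_zero : y 0 = 0
  x_end : x p = 1
  y_end : y p = 0
  x_le : ∀ t ∈ Icc 0 p, |x t| ≤ 2
  y_le : ∀ t ∈ Icc 0 p, |y t| ≤ 2

namespace ScaledOrbit

variable {f₁ g₂ g₃ B ε c p : ℝ} {φ γ x y : ℝ → ℝ}

lemma p_pos (h : ScaledOrbit f₁ g₂ g₃ B ε c p φ γ x y) : 0 ≤ p := by
  linarith [h.p_mem.1, pi_pos]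

lemma p_le (h : ScaledOrbit f₁ g₂ g₃ B ε c p φ γ x y) : p ≤ 8 :=
  h.p_mem.2.trans seven_pi_div_three_le

lemma near_cos (h : ScaledOrbit f₁ g₂ g₃ B ε c p φ γ x y) :
    ∀ t ∈ Icc 0 p, |x t - cos t| ≤ 176 * B * c ∧ |y t + sin t| ≤ 176 * B * c := by
  intro t ht
  have hB := h.one_le
  have hc := h.c_pos
  have := abs_sub_harmonic_le (E := 11 * B * c) h.deriv_x h.deriv_y ?_ t ht
  · simp only [h.x_zero, h.y_zero, one_mul, zero_mul, add_zero, zero_sub, sub_neg_eq_add] at this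
    have hp : 2 * (11 * B * c) * p ≤ 176 * B * c := by
      have := mul_le_mul_of_nonneg_left h.p_le (show 0 ≤ 2 * (11 * B * c) by positivity)
      linarith
    exact ⟨this.1.trans hp, this.2.trans hp⟩
  intro s hs
  have hx := h.x_le s hs
  have h1 := h.φ_near _ hx
  have h2 := h.γ_near _ hx
  have h3 := abs_mul_le_of_abs_le h.f₁_le hx
  have h4 : |φ (x s)| ≤ 2 * B + 1 := by
    have := abs_add_le (φ (x s) - f₁ * x s) (f₁ * x s)
    rw [sub_add_cancel] at this
    linarith [h.ε_le]
  have h5 := abs_mul_le_of_abs_le h4 (h.y_le s hs)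
  have hx2 : |x s ^ 2| ≤ 4 := by
    rw [abs_pow]; exact (pow_le_pow_left₀ (abs_nonneg _) hx 2).trans (by norm_num)
  have hx3 : |x s ^ 3| ≤ 8 := by
    rw [abs_pow]; exact (pow_le_pow_left₀ (abs_nonneg _) hx 3).trans (by norm_num)
  have h6 := abs_mul_le_of_abs_le h.g₂_le hx2
  have h7 := abs_mul_le_of_abs_le (abs_le.2 ⟨by linarith, h.c_le⟩ : |c| ≤ 1)
    (abs_mul_le_of_abs_le h.g₃_le hx3)
  have h8 : ε * c ≤ 1 := mul_le_one₀ h.ε_le hc.le h.c_le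
  rw [abs_mul, abs_of_pos hc, mul_comm]
  refine mul_le_mul_of_nonneg_right ?_ hc.le
  rw [abs_le] at *
  constructor <;> linarith

lemma near_firstCorrection (h : ScaledOrbit f₁ g₂ g₃ B ε c p φ γ x y) :
    ∀ t ∈ Icc 0 p, |x t - cos t - c * firstCorrection f₁ g₂ t| ≤
      12800 * B ^ 2 * (ε + c) * c := by
  intro t ht
  have hB := h.one_le
  have hc := h.c_pos
  have hε := h.ε_nonneg
  have := abs_sub_harmonic_le (E := 800 * B ^ 2 * (ε + c) * c)
    (y := fun t => x t - cos t - c * firstCorrection f₁ g₂ t)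
    (w := fun t => y t + sin t - c * firstCorrectionDeriv f₁ g₂ t)
    (e := fun t => c * (φ (x t) * y t + γ (x t) -
      (-(f₁ * (cos t * sin t)) + g₂ / 2 * cos t ^ 2)))
    (fun s hs => (((h.deriv_x s hs).sub (hasDerivAt_cos s)).sub
      ((hasDerivAt_firstCorrection f₁ g₂ s).const_mul c)).congr_deriv (by ring))
    (fun s hs => (((h.deriv_y s hs).add (hasDerivAt_sin s)).sub
      ((hasDerivAt_firstCorrectionDeriv f₁ g₂ s).const_mul c)).congr_deriv (by ring)) ?_ t ht
  · have h1 := this.1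
    have e1 : x 0 - cos 0 - c * firstCorrection f₁ g₂ 0 = 0 := by
      simp [firstCorrection, h.x_zero]; right; right; norm_num
    have e2 : y 0 + sin 0 - c * firstCorrectionDeriv f₁ g₂ 0 = 0 := by
      simp [firstCorrectionDeriv, h.y_zero]
    simp only [e1, e2, zero_mul, add_zero, sub_zero] at h1
    refine h1.trans ?_
    have := mul_le_mul_of_nonneg_left h.p_le
      (show 0 ≤ 2 * (800 * B ^ 2 * (ε + c) * c) by positivity)
    linarith
  intro s hs
  have hx := h.x_le s hs
  have hy := h.y_le s hs
  have hcs := abs_cos_le_one s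
  obtain ⟨n1, n2⟩ := h.near_cos s hs
  have h1 := abs_mul_le_of_abs_le (h.φ_near _ hx) hy
  have h2 := h.γ_near _ hx
  have h3 : |(x s - cos s) * y s + cos s * (y s + sin s)| ≤ 528 * B * c := by
    have := abs_add_le ((x s - cos s) * y s) (cos s * (y s + sin s))
    have := abs_mul_le_of_abs_le n1 hy
    have := abs_mul_le_of_abs_le hcs n2
    linarith
  have h4 := abs_mul_le_of_abs_le h.f₁_le h3
  have h5 : |x s + cos s| ≤ 3 := (abs_add_le _ _).trans (by linarith)
  have h6 := abs_mul_le_of_abs_le h.g₂_le (abs_mul_le_of_abs_le h5 n1)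
  have hx3 : |x s ^ 3| ≤ 8 := by
    rw [abs_pow]; exact (pow_le_pow_left₀ (abs_nonneg _) hx 3).trans (by norm_num)
  have h7 := abs_mul_le_of_abs_le (abs_of_pos hc).le (abs_mul_le_of_abs_le h.g₃_le hx3)
  have k1 : ε * c ≤ ε := mul_le_of_le_one_right hε h.c_le
  have k2 : c * B ≤ c * B ^ 2 := mul_le_mul_of_nonneg_left (le_self_pow₀ hB two_ne_zero) hc.le
  have k3 : ε ≤ B ^ 2 * ε := le_mul_of_one_le_left hε (one_le_pow₀ hB)
  rw [abs_mul, abs_of_pos hc, mul_comm]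
  refine mul_le_mul_of_nonneg_right ?_ hc.le
  have e : φ (x s) * y s + γ (x s) - (-(f₁ * (cos s * sin s)) + g₂ / 2 * cos s ^ 2) =
      (φ (x s) - f₁ * x s) * y s
      + (γ (x s) - (g₂ * x s ^ 2 / 2 + c * (g₃ * x s ^ 3 / 6)))
      + f₁ * ((x s - cos s) * y s + cos s * (y s + sin s))
      + (g₂ * ((x s + cos s) * (x s - cos s))) / 2
      + c * (g₃ * x s ^ 3) / 6 := by ring
  rw [e]
  rw [abs_le] at h1 h2 h4 h6 h7 ⊢
  constructor <;> linarith

/-- A second order primitive along the orbit. -/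
noncomputable def primitive (f₁ c : ℝ) (R S x y : ℝ → ℝ) (t : ℝ) : ℝ :=
  y t * cos t + x t * sin t + c * ((f₁ * x t ^ 2 / 2 + R (x t)) * cos t) - c * S (cos t)

/-- The part of `primitive` of first order in `c`. -/
noncomputable def linearPrimitive (f₁ g₂ t : ℝ) : ℝ :=
  -(g₂ / 2 * (sin t - sin t ^ 3 / 3)) + f₁ / 6 * cos t ^ 3

lemma hasDerivAt_linearPrimitive (f₁ g₂ t : ℝ) : HasDerivAt (linearPrimitive f₁ g₂)
    (-(g₂ / 2 * cos t ^ 3) - f₁ / 2 * cos t ^ 2 * sin t) t := by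
  have hs := hasDerivAt_sin t
  have hc := hasDerivAt_cos t
  refine (((hs.sub ((hs.pow 3).div_const 3)).const_mul (g₂ / 2)).neg.add
    ((hc.pow 3).const_mul (f₁ / 6))).congr_deriv ?_
  push_cast
  linear_combination (g₂ / 2 * cos t) * sin_sq_add_cos_sq t

lemma abs_primitive_sub_le (h : ScaledOrbit f₁ g₂ g₃ B ε c p φ γ x y) {R S : ℝ → ℝ}
    (hR : ∀ z, HasDerivAt R (φ z - f₁ * z) z) (hS : ∀ z, HasDerivAt S (R z) z) :
    |(primitive f₁ c R S x y p - c * linearPrimitive f₁ g₂ p - c ^ 2 * periodPrimitive f₁ g₂ g₃ p)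
      - (primitive f₁ c R S x y 0 - c * linearPrimitive f₁ g₂ 0
        - c ^ 2 * periodPrimitive f₁ g₂ g₃ 0)| ≤ 500000 * B ^ 3 * c ^ 2 * (ε + c) := by
  have hB := h.one_le
  have hc := h.c_pos
  have hε := h.ε_nonneg
  have hd : ∀ t ∈ Icc 0 p, HasDerivWithinAt (fun t => primitive f₁ c R S x y t
      - c * linearPrimitive f₁ g₂ t - c ^ 2 * periodPrimitive f₁ g₂ g₃ t)
      (-(c * (cos t * (γ (x t) - (g₂ * x t ^ 2 / 2 + c * (g₃ * x t ^ 3 / 6)))))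
        - c * ((R (x t) - R (cos t)) * sin t)
        - c * (g₂ * (x t ^ 2 - cos t ^ 2 - 2 * c * cos t * firstCorrection f₁ g₂ t) * cos t) / 2
        - c * c * (g₃ * (cos t * (x t ^ 3 - cos t ^ 3))) / 6
        - c * (f₁ * (x t ^ 2 - cos t ^ 2 - 2 * c * cos t * firstCorrection f₁ g₂ t) * sin t) / 2)
      (Icc 0 p) t := by
    intro t ht
    have hs := hasDerivAt_sin t
    have hco := hasDerivAt_cos t
    have hx := h.deriv_x t ht
    have hRx : HasDerivAt (fun t => R (x t)) _ t := (hR (x t)).comp t hx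
    have hSc : HasDerivAt (fun t => S (cos t)) _ t := (hS (cos t)).comp t hco
    have := (((((h.deriv_y t ht).mul hco).add (hx.mul hs)).add
      ((((((hx.pow 2).const_mul f₁).div_const 2).add hRx).mul hco).const_mul c)).sub
      (hSc.const_mul c)).sub ((hasDerivAt_linearPrimitive f₁ g₂ t).const_mul c) |>.sub
      ((hasDerivAt_periodPrimitive f₁ g₂ g₃ t).const_mul (c ^ 2))
    refine (this.congr_deriv ?_).hasDerivWithinAt
    simp only [periodIntegrand, Pi.add_apply, Pi.pow_apply]
    push_cast
    ring
  have bd := (convex_Icc 0 p).norm_image_sub_le_of_norm_hasDerivWithin_le hd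
    (C := 62500 * B ^ 3 * c ^ 2 * (ε + c)) ?_ (x := 0) (y := p)
    ⟨le_rfl, h.p_pos⟩ ⟨h.p_pos, le_rfl⟩
  · refine bd.trans ?_
    rw [norm_eq_abs, sub_zero, abs_of_nonneg h.p_pos]
    have := mul_le_mul_of_nonneg_left h.p_le
      (show 0 ≤ 62500 * B ^ 3 * c ^ 2 * (ε + c) by positivity)
    linarith
  intro t ht
  rw [norm_eq_abs]
  have hx := h.x_le t ht
  have hcs := abs_cos_le_one t
  have hsn := abs_sin_le_one t
  have n1 := (h.near_cos t ht).1
  have n2 := h.near_firstCorrection t ht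
  have hcabs : |c| ≤ c := (abs_of_pos hc).le
  have hRl : |R (x t) - R (cos t)| ≤ ε * (176 * B * c) := by
    have := (convex_Icc (-2 : ℝ) 2).norm_image_sub_le_of_norm_hasDerivWithin_le (C := ε)
      (fun z _ => (hR z).hasDerivWithinAt)
      (fun z hz => h.φ_near z (abs_le.2 hz)) (abs_le.1 (hcs.trans one_le_two)) (abs_le.1 hx)
    exact this.trans (mul_le_mul_of_nonneg_left n1 hε)
  have hsq : |x t ^ 2 - cos t ^ 2 - 2 * c * cos t * firstCorrection f₁ g₂ t| ≤
      60000 * B ^ 2 * (ε + c) * c := by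
    have e : x t ^ 2 - cos t ^ 2 - 2 * c * cos t * firstCorrection f₁ g₂ t =
        2 * (cos t * (x t - cos t - c * firstCorrection f₁ g₂ t))
        + (x t - cos t) * (x t - cos t) := by ring
    have k1 := abs_mul_le_of_abs_le hcs n2
    have k2 := abs_mul_le_of_abs_le n1 n1
    have k3 : 0 ≤ B ^ 2 * ε * c := by positivity
    have k4 : 0 ≤ B ^ 2 * c * c := by positivity
    rw [e]
    rw [abs_le] at k1 k2 ⊢
    constructor <;> nlinarith
  have hcu : |x t ^ 3 - cos t ^ 3| ≤ 7 * (176 * B * c) := by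
    have e : x t ^ 3 - cos t ^ 3 = (x t ^ 2 + x t * cos t + cos t ^ 2) * (x t - cos t) := by ring
    rw [e]
    refine abs_mul_le_of_abs_le ?_ n1
    have := abs_mul_le_of_abs_le hx hcs
    rw [abs_le] at *
    constructor <;> nlinarith
  have t1 := abs_mul_le_of_abs_le hcabs
    (abs_mul_le_of_abs_le hcs (h.γ_near _ hx))
  have t2 := abs_mul_le_of_abs_le hcabs (abs_mul_le_of_abs_le hRl hsn)
  have t3 := abs_mul_le_of_abs_le hcabs
    (abs_mul_le_of_abs_le (abs_mul_le_of_abs_le h.g₂_le hsq) hcs)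
  have t4 := abs_mul_le_of_abs_le (abs_mul_le_of_abs_le hcabs hcabs)
    (abs_mul_le_of_abs_le h.g₃_le (abs_mul_le_of_abs_le hcs hcu))
  have t5 := abs_mul_le_of_abs_le hcabs
    (abs_mul_le_of_abs_le (abs_mul_le_of_abs_le h.f₁_le hsq) hsn)
  have b1 : 1 ≤ B ^ 3 := one_le_pow₀ hB
  have b2 : B ≤ B ^ 3 := le_self_pow₀ hB (by norm_num)
  have b3 : B ^ 2 ≤ B ^ 3 := pow_le_pow_right₀ hB (by norm_num)
  have m1 : 1 * (c ^ 2 * ε) ≤ B ^ 3 * (c ^ 2 * ε) := mul_le_mul_of_nonneg_right b1 (by positivity)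
  have m2 : B * (c ^ 2 * ε) ≤ B ^ 3 * (c ^ 2 * ε) := mul_le_mul_of_nonneg_right b2 (by positivity)
  have m3 : B ^ 2 * c ^ 3 ≤ B ^ 3 * c ^ 3 := mul_le_mul_of_nonneg_right b3 (by positivity)
  have m4 : 0 ≤ B ^ 3 * c ^ 3 := by positivity
  have m5 : 0 ≤ B ^ 3 * (c ^ 2 * ε) := by positivity
  rw [abs_le] at t1 t2 t3 t4 t5 ⊢
  ring_nf at t1 t2 t3 t4 t5 m1 m2 m3 m4 m5 ⊢
  constructor <;> linarith

lemma abs_linearPrimitive_sub_le (hf : |f₁| ≤ B) (hg : |g₂| ≤ B) {t : ℝ} (ht : 0 ≤ cos t) :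
    |linearPrimitive f₁ g₂ t - linearPrimitive f₁ g₂ 0| ≤ 2 * B * |sin t| := by
  have hsn := abs_sin_le_one t
  have hB : 0 ≤ B := (abs_nonneg _).trans hf
  have hk := cos_le_one t
  have hsc := sin_sq_add_cos_sq t
  have h0 := abs_nonneg (sin t)
  have hsq : sin t ^ 2 ≤ |sin t| := by rw [← sq_abs]; nlinarith
  have h1 : |sin t - sin t ^ 3 / 3| ≤ |sin t| := by
    rw [show sin t - sin t ^ 3 / 3 = sin t * (1 - sin t ^ 2 / 3) by ring, abs_mul]
    refine mul_le_of_le_one_right h0 (abs_le.2 ⟨?_, ?_⟩) <;> nlinarith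
  have h2 : |cos t ^ 3 - 1| ≤ 3 * |sin t| := by
    have e : 1 - cos t ≤ sin t ^ 2 := by nlinarith
    rw [abs_le]
    constructor <;> nlinarith [sq_nonneg (cos t), mul_nonneg ht (sq_nonneg (cos t))]
  have h3 := abs_mul_le_of_abs_le hg h1
  have h4 := abs_mul_le_of_abs_le hf h2
  have e : linearPrimitive f₁ g₂ t - linearPrimitive f₁ g₂ 0 =
      -(g₂ * (sin t - sin t ^ 3 / 3)) / 2 + f₁ * (cos t ^ 3 - 1) / 6 := by
    simp only [linearPrimitive, sin_zero, cos_zero]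
    ring
  have := mul_nonneg hB h0
  rw [e]
  rw [abs_le] at h3 h4 ⊢
  constructor <;> linarith

lemma abs_periodPrimitive_sub_le (hB : 1 ≤ B) (hf : |f₁| ≤ B) (hg : |g₂| ≤ B) (hg₃ : |g₃| ≤ B)
    {t : ℝ} (ht : |t - 2 * π| ≤ π / 3) :
    |periodPrimitive f₁ g₂ g₃ t - periodPrimitive f₁ g₂ g₃ 0 - periodCoeff f₁ g₂ g₃| ≤
      10 * B ^ 2 * |sin t| := by
  have h1 := convex_univ.norm_image_sub_le_of_norm_hasDerivWithin_le (C := 5 * B ^ 2)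
    (fun z _ => (hasDerivAt_periodPrimitive f₁ g₂ g₃ z).hasDerivWithinAt)
    (fun z _ => abs_periodIntegrand_le hB hf hg hg₃ z) (mem_univ (2 * π)) (mem_univ t)
  have h2 := (abs_sub_sin_le ht).1
  rw [sin_sub_two_pi] at h2
  rw [← periodPrimitive_two_pi_sub, sub_sub_sub_cancel_right]
  have := mul_le_mul_of_nonneg_left h2 (show 0 ≤ 5 * B ^ 2 by positivity)
  rw [norm_eq_abs, norm_eq_abs] at h1
  linarith

/-- Second order expansion of the period of a scaled orbit. -/
lemma abs_period_sub_le (h : ScaledOrbit f₁ g₂ g₃ B ε c p φ γ x y) :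
    |p - 2 * π - periodCoeff f₁ g₂ g₃ * c ^ 2| ≤ 10 ^ 13 * B ^ 6 * (ε + c) * c ^ 2 := by
  have hB := h.one_le
  have hc := h.c_pos
  have hc1 := h.c_le
  have hε := h.ε_nonneg
  have hε1 := h.ε_le
  have hp : |p - 2 * π| ≤ π / 3 := abs_le.2 ⟨by linarith [h.p_mem.1], by linarith [h.p_mem.2]⟩
  have hρ : Continuous fun z => φ z - f₁ * z := h.φ_cont.sub (continuous_const.mul continuous_id)
  set R : ℝ → ℝ := fun z => ∫ s in (0 : ℝ)..z, (φ s - f₁ * s) with hRdef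
  have hR : ∀ z, HasDerivAt R (φ z - f₁ * z) z := fun z =>
    (hρ.integral_hasStrictDerivAt 0 z).hasDerivAt
  have hRc : Continuous R := continuous_iff_continuousAt.2 fun z => (hR z).continuousAt
  set S : ℝ → ℝ := fun z => ∫ s in (0 : ℝ)..z, R s with hSdef
  have hS : ∀ z, HasDerivAt S (R z) z := fun z =>
    (hRc.integral_hasStrictDerivAt 0 z).hasDerivAt
  have hR0 : R 0 = 0 := by simp [hRdef]
  have hR1 : ∀ z ∈ Icc (-1 : ℝ) 1, |R z| ≤ ε := by
    intro z hz
    have := (convex_Icc (-1 : ℝ) 1).norm_image_sub_le_of_norm_hasDerivWithin_le (C := ε)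
      (fun z _ => (hR z).hasDerivWithinAt)
      (fun z hz => h.φ_near z ((abs_le.2 hz).trans one_le_two)) (x := 0) ⟨by norm_num, by norm_num⟩ hz
    rw [hR0, sub_zero, sub_zero] at this
    exact this.trans (mul_le_of_le_one_right hε (abs_le.2 hz))
  have hk0 : 1 / 2 ≤ cos p := half_le_cos_of_mem_Icc h.p_mem
  have hk1 := cos_le_one p
  have hk : 1 - cos p ≤ sin p ^ 2 := by nlinarith [sin_sq_add_cos_sq p]
  have hSb : |S (cos p) - S 1| ≤ ε * sin p ^ 2 := by
    have := (convex_Icc (-1 : ℝ) 1).norm_image_sub_le_of_norm_hasDerivWithin_le (C := ε)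
      (fun z _ => (hS z).hasDerivWithinAt) hR1 (x := 1) ⟨by norm_num, le_rfl⟩
      ⟨neg_one_le_cos p, cos_le_one p⟩
    refine this.trans (mul_le_mul_of_nonneg_left ?_ hε)
    rwa [norm_eq_abs, abs_sub_comm, abs_of_nonneg (by linarith)]
  have hRb : |(f₁ / 2 + R 1) * (1 - cos p)| ≤ 2 * B * sin p ^ 2 := by
    refine abs_mul_le_of_abs_le ?_ (by rwa [abs_of_nonneg (by linarith)])
    have h1 := hR1 1 (by simp)
    have h2 := h.f₁_le
    rw [abs_le] at *
    constructor <;> linarith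
  have hD := h.abs_primitive_sub_le hR hS
  have hW₂ := abs_linearPrimitive_sub_le h.f₁_le h.g₂_le (t := p) (by linarith)
  have hW₃ := abs_periodPrimitive_sub_le hB h.f₁_le h.g₂_le h.g₃_le hp
  have hA := abs_periodCoeff_le hB h.f₁_le h.g₂_le h.g₃_le
  set A := periodCoeff f₁ g₂ g₃
  have hσ : |sin p| ≤ 176 * B * c := by
    have := (h.near_cos p ⟨h.p_pos, le_rfl⟩).2
    rwa [h.y_end, zero_add] at this
  have hσ1 := abs_sin_le_one p
  have hσsq : sin p ^ 2 ≤ |sin p| := by rw [← sq_abs]; nlinarith [abs_nonneg (sin p)]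
  have key : |sin p - A * c ^ 2| ≤
      500000 * B ^ 3 * c ^ 2 * (ε + c) + 15 * B ^ 2 * c * |sin p| := by
    have e : sin p - A * c ^ 2 =
        ((primitive f₁ c R S x y p - c * linearPrimitive f₁ g₂ p
            - c ^ 2 * periodPrimitive f₁ g₂ g₃ p)
          - (primitive f₁ c R S x y 0 - c * linearPrimitive f₁ g₂ 0
            - c ^ 2 * periodPrimitive f₁ g₂ g₃ 0))
        + c * (linearPrimitive f₁ g₂ p - linearPrimitive f₁ g₂ 0)
        + c ^ 2 * (periodPrimitive f₁ g₂ g₃ p - periodPrimitive f₁ g₂ g₃ 0 - A)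
        + c * ((f₁ / 2 + R 1) * (1 - cos p)) + c * (S (cos p) - S 1) := by
      simp only [primitive, h.x_end, h.y_end, h.x_zero, h.y_zero, cos_zero, sin_zero]
      ring
    have t1 := abs_mul_le_of_abs_le (abs_of_pos hc).le hW₂
    have t2 := abs_mul_le_of_abs_le (abs_of_pos (pow_pos hc 2)).le hW₃
    have t3 := abs_mul_le_of_abs_le (abs_of_pos hc).le hRb
    have t4 := abs_mul_le_of_abs_le (abs_of_pos hc).le hSb
    have hn := abs_nonneg (sin p)
    have m1 : B * (c * |sin p|) ≤ B ^ 2 * (c * |sin p|) :=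
      mul_le_mul_of_nonneg_right (le_self_pow₀ hB two_ne_zero) (by positivity)
    have m2 : c ^ 2 * (B ^ 2 * |sin p|) ≤ c * (B ^ 2 * |sin p|) :=
      mul_le_mul_of_nonneg_right (pow_le_of_le_one hc.le hc1 two_ne_zero) (by positivity)
    have m3 : (c * B) * sin p ^ 2 ≤ (c * B) * |sin p| :=
      mul_le_mul_of_nonneg_left hσsq (by positivity)
    have m4 : (c * ε) * sin p ^ 2 ≤ (c * B) * |sin p| := by
      gcongr
      linarith
    rw [e]
    rw [abs_le] at hD t1 t2 t3 t4 ⊢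
    constructor <;> linarith
  have hσ2 : |sin p| ≤ 10 ^ 7 * B ^ 3 * c ^ 2 := by
    have m1 := mul_le_mul_of_nonneg_left hσ (show 0 ≤ 15 * B ^ 2 * c by positivity)
    have m2 := mul_le_mul_of_nonneg_left (show ε + c ≤ 2 by linarith)
      (show 0 ≤ 500000 * B ^ 3 * c ^ 2 by positivity)
    have m3 := mul_le_mul_of_nonneg_right hA (sq_nonneg c)
    have m4 : B ^ 2 * c ^ 2 ≤ B ^ 3 * c ^ 2 :=
      mul_le_mul_of_nonneg_right (pow_le_pow_right₀ hB (by norm_num)) (by positivity)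
    have m5 : 0 ≤ B ^ 3 * c ^ 2 := by positivity
    have := abs_add_le (sin p - A * c ^ 2) (A * c ^ 2)
    rw [sub_add_cancel, abs_mul, abs_of_pos (pow_pos hc 2)] at this
    linarith
  have hq := (abs_sub_sin_le hp).2
  rw [sin_sub_two_pi] at hq
  have hcube : 2 * |sin p| ^ 3 ≤ 2 * 10 ^ 7 * B ^ 3 * c ^ 2 * (176 * B * c) := by
    have e : 2 * |sin p| ^ 3 ≤ 2 * (|sin p| * |sin p|) := by
      nlinarith [abs_nonneg (sin p), mul_self_nonneg |sin p|]
    have := mul_le_mul hσ2 hσ (abs_nonneg _) (by positivity)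
    linarith
  have m1 := mul_le_mul_of_nonneg_left hσ2 (show 0 ≤ 15 * B ^ 2 * c by positivity)
  have b3 : B ^ 3 * (c ^ 2 * (ε + c)) ≤ B ^ 6 * (c ^ 2 * (ε + c)) :=
    mul_le_mul_of_nonneg_right (pow_le_pow_right₀ hB (by norm_num)) (by positivity)
  have b4 : B ^ 4 * c ^ 3 ≤ B ^ 6 * c ^ 3 :=
    mul_le_mul_of_nonneg_right (pow_le_pow_right₀ hB (by norm_num)) (by positivity)
  have b5 : B ^ 5 * c ^ 3 ≤ B ^ 6 * c ^ 3 :=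
    mul_le_mul_of_nonneg_right (pow_le_pow_right₀ hB (by norm_num)) (by positivity)
  have b6 : 0 ≤ B ^ 6 * (c ^ 2 * ε) := by positivity
  have b7 : 0 ≤ B ^ 6 * c ^ 3 := by positivity
  have := abs_add_le (p - 2 * π - sin p) (sin p - A * c ^ 2)
  rw [sub_add_sub_cancel] at this
  refine this.trans ((add_le_add hq key).trans ?_)
  nlinarith

end ScaledOrbit

lemma SmallTerms.continuousOn_F {F G : ℝ → ℝ} {K r : ℝ} (h : SmallTerms F G K r) :
    ContinuousOn F (Icc (-r) r) := by
  refine (LipschitzOnWith.of_dist_le_mul (K := ⟨K, h.K_nonneg⟩) fun x hx y hy => ?_).continuousOn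
  rw [dist_eq, dist_eq]
  exact h.F_lip x y (abs_le.2 hx) (abs_le.2 hy)

lemma IsFlow.exists_scaledOrbit {F G u v : ℝ → ℝ} {K r c p f₁ g₂ g₃ ε : ℝ} (h : IsFlow F G u v)
    (hFG : SmallTerms F G K r) (hc : SmallAmp K r (2 * c)) (hc0 : 0 < c) (hc1 : c ≤ 1)
    (hu0 : u 0 = c) (hv0 : v 0 = 0) (hp : IsLeast {p | 0 < p ∧ ∀ t, u (t + p) = u t} p)
    (hε0 : 0 ≤ ε) (hε1 : ε ≤ 1) (hF : ∀ x, |x| ≤ 2 * c → |F x - f₁ * x| ≤ ε / 2 * |x|)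
    (hG : ∀ x, |x| ≤ 2 * c → |G x - (g₂ * x ^ 2 / 2 + g₃ * x ^ 3 / 6)| ≤ ε / 8 * |x| ^ 3) :
    ∃ φ γ x y, ScaledOrbit f₁ g₂ g₃ (1 + |f₁| + |g₂| + |g₃|) ε c p φ γ x y := by
  have hpi := pi_gt_three
  obtain ⟨⟨hp0, hup⟩, hmin⟩ := hp
  have hvp : Function.Periodic v p := fun t =>
    ((h (t + p)).1.comp_add_const t p).unique (by simpa only [hup] using (h t).1)
  have hc' := hc.mono hFG.K_nonneg hc0.le (by linarith)
  obtain ⟨t₁, ht₁, hvt, hut, huniq⟩ := h.exists_return_eq hFG hc hc0 hu0 hv0 hp0 hup hvp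
  have hle : p ≤ t₁ := hmin ⟨by linarith [ht₁.1],
    h.periodic_of_return hFG hc' hc0 hu0 hv0 ⟨by linarith [ht₁.1], ht₁.2⟩ hvt hut hp0 hup⟩
  have hupc : u p = c := by simpa [hu0] using hup 0
  have hvp0 : v p = 0 := by simpa [hv0] using hvp 0
  obtain rfl : p = t₁ := huniq p ⟨hp0, hle.trans ht₁.2⟩ hvp0 (by rwa [hupc])
  have hcr : 2 * c ≤ r := by linarith [hc'.le_r]
  have hr : -r ≤ r := by linarith
  have hbd : ∀ z, |z| ≤ 2 → |c * z| ≤ 2 * c := fun z hz => by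
    rw [abs_mul, abs_of_pos hc0]; nlinarith
  have hext : ∀ z, |z| ≤ 2 → IccExtend hr ((Icc (-r) r).domRestrict F) (c * z) = F (c * z) :=
    fun z hz => IccExtend_of_mem hr _ (abs_le.1 ((hbd z hz).trans hcr))
  have hb : ∀ t ∈ Icc 0 p, |u t| ≤ 2 * c ∧ |v t| ≤ 2 * c := fun t ht =>
    h.abs_le_two_mul hFG hc' hc0 hu0 hv0 ⟨ht.1, ht.2.trans ht₁.2⟩
  have hdiv : ∀ w, |w| ≤ 2 * c → |w / c| ≤ 2 := fun w hw => by
    rwa [abs_div, abs_of_pos hc0, div_le_iff₀ hc0]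
  refine ⟨fun z => IccExtend hr ((Icc (-r) r).domRestrict F) (c * z) / c,
    fun z => G (c * z) / c ^ 2, fun t => u t / c, fun t => v t / c, ?_⟩
  have n1 := abs_nonneg f₁
  have n2 := abs_nonneg g₂
  have n3 := abs_nonneg g₃
  refine
    { one_le := by linarith, f₁_le := by linarith, g₂_le := by linarith, g₃_le := by linarith,
      ε_nonneg := hε0, ε_le := hε1, c_pos := hc0, c_le := hc1, p_mem := ht₁,
      φ_cont := ?_, φ_near := ?_, γ_near := ?_, deriv_x := fun t _ => (h t).1.div_const c,
      deriv_y := ?_, x_zero := ?_, y_zero := ?_, x_end := ?_, y_end := ?_,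
      x_le := fun t ht => hdiv _ (hb t ht).1, y_le := fun t ht => hdiv _ (hb t ht).2 }
  · have := (hFG.continuousOn_F.domRestrict).Icc_extend' (h := hr)
    fun_prop
  · intro z hz
    have h1 := hF _ (hbd z hz)
    have h2 : F (c * z) / c - f₁ * z = (F (c * z) - f₁ * (c * z)) / c := by field_simp
    rw [hext z hz, h2, abs_div, abs_of_pos hc0, div_le_iff₀ hc0]
    refine h1.trans ?_
    nlinarith [mul_le_mul_of_nonneg_left (hbd z hz) hε0]
  · intro z hz
    have h1 := hG _ (hbd z hz)
    have h2 : G (c * z) / c ^ 2 - (g₂ * z ^ 2 / 2 + c * (g₃ * z ^ 3 / 6)) =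
        (G (c * z) - (g₂ * (c * z) ^ 2 / 2 + g₃ * (c * z) ^ 3 / 6)) / c ^ 2 := by field_simp
    rw [h2, abs_div, abs_of_pos (by positivity : 0 < c ^ 2), div_le_iff₀ (by positivity)]
    refine h1.trans ?_
    have h3 : |c * z| ^ 3 ≤ (2 * c) ^ 3 := pow_le_pow_left₀ (abs_nonneg _) (hbd z hz) 3
    nlinarith [mul_le_mul_of_nonneg_left h3 hε0]
  · intro t ht
    have h1 := (h t).2.div_const c
    have h2 : c * (u t / c) = u t := by field_simp
    refine h1.congr_deriv ?_
    rw [hext _ (hdiv _ (hb t ht).1), h2]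
    field_simp
  · rw [hu0, div_self hc0.ne']
  · rw [hv0, zero_div]
  · rw [hupc, div_self hc0.ne']
  · rw [hvp0, zero_div]

/-- Near the origin, a center of `u'' + u + F(u) u' + G(u) = 0` with
`F(x) = f₁ x + o(x)` and `G(x) = g₂ x² / 2 + g₃ x³ / 6 + o(x³)` has period function
`2π + periodCoeff f₁ g₂ g₃ c² + o(c²)`. -/
lemma SmallTerms.eventually_abs_period_sub_le {F G : ℝ → ℝ} {K r f₁ g₂ g₃ : ℝ}
    (hFG : SmallTerms F G K r) (hr : 0 < r)
    (hF : (fun x => F x - f₁ * x) =o[nhds 0] fun x => x)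
    (hG : (fun x => G x - (g₂ * x ^ 2 / 2 + g₃ * x ^ 3 / 6)) =o[nhds 0] fun x => x ^ 3)
    {ε : ℝ} (hε : 0 < ε) :
    ∀ᶠ c in nhdsWithin 0 (Ioi (0 : ℝ)), ∀ u v p, IsFlow F G u v → u 0 = c → v 0 = 0 →
      IsLeast {p | 0 < p ∧ ∀ t, u (t + p) = u t} p →
      |p - 2 * π - periodCoeff f₁ g₂ g₃ * c ^ 2| ≤ ε * c ^ 2 := by
  have hK := hFG.K_nonneg
  obtain ⟨C, hC⟩ : ∃ C, C = 10 ^ 13 * (1 + |f₁| + |g₂| + |g₃|) ^ 6 := ⟨_, rfl⟩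
  have hC0 : 0 < C := by rw [hC]; positivity
  obtain ⟨e, he⟩ : ∃ e, e = min 1 (ε / (2 * C)) := ⟨_, rfl⟩
  have he0 : 0 < e := by rw [he]; positivity
  have heC : C * e ≤ ε / 2 := by
    have : e ≤ ε / (2 * C) := he ▸ min_le_right _ _
    calc C * e ≤ C * (ε / (2 * C)) := mul_le_mul_of_nonneg_left this hC0.le
      _ = ε / 2 := by field_simp
  obtain ⟨ρ, hρ, hρb⟩ := Metric.eventually_nhds_iff.1
    ((hF.def (half_pos he0)).and (hG.def (c := e / 8) (by positivity)))
  have hη : 0 < min (min e (ρ / 3)) (min (r / 6) (1 / (12000 * (K + 1)))) := by positivity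
  filter_upwards [Ioo_mem_nhdsGT hη] with c hc u v p h hu0 hv0 hp
  obtain ⟨hc0, hc1⟩ := hc
  simp only [lt_min_iff] at hc1
  obtain ⟨⟨hce, hcρ⟩, hcr, hcK⟩ := hc1
  have he1 : e ≤ 1 := he ▸ min_le_left _ _
  rw [lt_div_iff₀ (by positivity)] at hcK
  have hb : ∀ x, |x| ≤ 2 * c → dist x 0 < ρ := fun x hx => by
    rw [dist_zero_right, norm_eq_abs]; linarith
  obtain ⟨φ, γ, x, y, ho⟩ := h.exists_scaledOrbit hFG
    ⟨by linarith, by linarith, by nlinarith⟩ hc0 (hce.le.trans he1) hu0 hv0 hp he0.le he1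
    (fun x hx => (hρb (hb x hx)).1)
    (fun x hx => by simpa only [norm_eq_abs, abs_pow] using (hρb (hb x hx)).2)
  refine ho.abs_period_sub_le.trans ?_
  rw [← hC]
  refine mul_le_mul_of_nonneg_right ?_ (by positivity)
  nlinarith [mul_le_mul_of_nonneg_left hce.le hC0.le]

lemma exists_smallTerms {F G : ℝ → ℝ} (hF : ContDiffAt ℝ 1 F 0) (hG : ContDiffAt ℝ 2 G 0)
    (hF0 : F 0 = 0) (hG0 : G 0 = 0) (hG1 : deriv G 0 = 0) :
    ∃ K r, 0 < r ∧ SmallTerms F G K r := by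
  obtain ⟨K₁, s₁, hs₁, hL₁⟩ := hF.exists_lipschitzOnWith
  obtain ⟨K₂, s₂, hs₂, hL₂⟩ :=
    (hG.derivWithin (m := 1) (by norm_num)).exists_lipschitzOnWith
  have hd : ∀ᶠ x in nhds 0, DifferentiableAt ℝ G x :=
    (hG.eventually (by simp)).mono fun x hx => hx.differentiableAt (by simp)
  obtain ⟨r, hr, hrb⟩ := Metric.nhds_basis_closedBall.mem_iff.1
    (inter_mem (inter_mem hs₁ hs₂) hd)
  have hm : ∀ x, |x| ≤ r → (x ∈ s₁ ∧ x ∈ s₂) ∧ DifferentiableAt ℝ G x := fun x hx =>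
    hrb (by simpa using hx)
  have h0 : |(0 : ℝ)| ≤ r := by simpa using hr.le
  have hK : (0 : ℝ) ≤ max K₁ K₂ := le_max_of_le_left K₁.2
  refine ⟨max K₁ K₂, r, hr, hF0, hG0, hK, fun x y hx hy => ?_, fun x y hx hy => ?_⟩
  · refine (hL₁.dist_le_mul x (hm x hx).1.1 y (hm y hy).1.1).trans ?_
    exact mul_le_mul_of_nonneg_right (le_max_left _ _) (abs_nonneg _)
  · have hsub : ∀ z, |z| ≤ max |x| |y| → |z| ≤ r := fun z hz => hz.trans (max_le hx hy)
    have hmem : ∀ z, |z| ≤ max |x| |y| → z ∈ Icc (-max |x| |y|) (max |x| |y|) :=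
      fun z hz => abs_le.1 hz
    refine ((convex_Icc (-max |x| |y|) (max |x| |y|)).norm_image_sub_le_of_norm_deriv_le
      (C := max K₁ K₂ * (|x| + |y|)) (fun z hz => (hm z (hsub z (abs_le.2 hz))).2)
      (fun z hz => ?_) (hmem y (le_max_right _ _)) (hmem x (le_max_left _ _)))
    have hz' := abs_le.2 hz
    have h1 := hL₂.dist_le_mul z (hm z (hsub z hz')).1.2 0 (hm 0 h0).1.2
    rw [hG1, dist_zero_right, dist_zero_right, norm_eq_abs z] at h1
    exact h1.trans (mul_le_mul (le_max_right _ _)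
      (hz'.trans (max_le_add_of_nonneg (abs_nonneg _) (abs_nonneg _))) (abs_nonneg _) hK)

lemma isLittleO_taylor_three {a b : ℝ} (ha : a < 0) (hb : 0 < b) {g : ℝ → ℝ}
    (hg : ContDiffOn ℝ 3 g (Icc a b)) :
    (fun x => g x - (g 0 + deriv g 0 * x + iteratedDeriv 2 g 0 * x ^ 2 / 2 +
      iteratedDeriv 3 g 0 * x ^ 3 / 6)) =o[nhds 0] fun x => x ^ 3 := by
  have h0 : (0 : ℝ) ∈ Icc a b := ⟨ha.le, hb.le⟩
  have hu := uniqueDiffOn_Icc (ha.trans hb)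
  have hc : ContDiffAt ℝ 3 g 0 := hg.contDiffAt (Icc_mem_nhds ha hb)
  have h := taylor_isLittleO (n := 3) (convex_Icc a b) h0 hg
  rw [nhdsWithin_eq_nhds.2 (Icc_mem_nhds ha hb)] at h
  simp only [taylorWithinEval_succ, taylor_within_zero_eval, sub_zero, smul_eq_mul] at h
  rw [iteratedDerivWithin_eq_iteratedDeriv hu (hc.of_le (by norm_num)) h0,
    iteratedDerivWithin_eq_iteratedDeriv hu (hc.of_le (by norm_num)) h0,
    iteratedDerivWithin_eq_iteratedDeriv hu (hc.of_le (by norm_num)) h0] at h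
  refine h.congr_left fun x => ?_
  norm_num [Nat.factorial, iteratedDeriv_one]
  ring

lemma IsLienardSolution.isFlow {f g u : ℝ → ℝ} (h : IsLienardSolution f g u) {ω : ℝ}
    (hω : 0 < ω) :
    IsFlow (fun x => f x / ω) (fun x => g x / ω ^ 2 - x) (fun t => u (t / ω))
      (fun t => deriv u (t / ω) / ω) := by
  intro t
  have hl : HasDerivAt (fun t => t / ω) (1 / ω) t := (hasDerivAt_id t).div_const ω
  have h1 : HasDerivAt u (deriv u (t / ω)) (t / ω) :=
    (h.1.differentiable (by norm_num) _).hasDerivAt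
  have h2 : HasDerivAt (deriv u) (deriv (deriv u) (t / ω)) (t / ω) :=
    ((h.1.contDiffAt.derivWithin (m := 1) (by norm_num)).differentiableAt
      (by norm_num)).hasDerivAt
  have h2' : HasDerivAt (fun t => deriv u (t / ω)) (deriv (deriv u) (t / ω) * (1 / ω)) t :=
    HasDerivAt.comp (h₂ := deriv u) t h2 hl
  refine ⟨(h1.comp t hl).congr_deriv (mul_one_div _ _), (h2'.div_const ω).congr_deriv ?_⟩
  have h3 := h.2 (t / ω)
  field_simp
  linarith

/-- Expansion of the period function of the Liénard equation near the center:
`(T(c) − 2π/√g'(0))/c² → −(π/(12√g'(0)))((3/2)g'''(0)/g'(0) − (5/2)g''(0)²/g'(0)² − f'(0)²/g'(0))`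
as `c → 0⁺`. -/
theorem lienard_period_expansion
    (a b : ℝ) (ha : a < 0) (hb : 0 < b) (f g : ℝ → ℝ)
    (hf : ContDiffOn ℝ 1 f (Icc a b)) (hg : ContDiffOn ℝ 3 g (Icc a b))
    (hf0 : f 0 = 0) (hg0 : g 0 = 0) (hg'0 : 0 < deriv g 0)
    (δ : ℝ) (hδ : 0 < δ) (T : ℝ → ℝ)
    (hsol : ∀ c ∈ Ioo (0:ℝ) δ, ∃ u, IsLienardSolution f g u ∧ u 0 = c ∧ deriv u 0 = 0)
    (hcenter : ∀ c ∈ Ioo (0:ℝ) δ, ∀ u, IsLienardSolution f g u → u 0 = c → deriv u 0 = 0 →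
      ∃ p > 0, ∀ t, u (t + p) = u t)
    (hT : ∀ c ∈ Ioo (0:ℝ) δ, ∀ u, IsLienardSolution f g u → u 0 = c → deriv u 0 = 0 →
      IsLeast {p : ℝ | 0 < p ∧ ∀ t, u (t + p) = u t} (T c)) :
    Tendsto (fun c => (T c - 2 * π / Real.sqrt (deriv g 0)) / c ^ 2)
      (nhdsWithin 0 (Ioi (0:ℝ)))
      (nhds (-(π / (12 * Real.sqrt (deriv g 0))) *
        ((3 / 2) * iteratedDeriv 3 g 0 / deriv g 0
          - (5 / 2) * (iteratedDeriv 2 g 0) ^ 2 / (deriv g 0) ^ 2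
          - (deriv f 0) ^ 2 / deriv g 0))) := by
  obtain ⟨ω, hωdef⟩ : ∃ ω, ω = √(deriv g 0) := ⟨_, rfl⟩
  have hω : 0 < ω := hωdef ▸ sqrt_pos.2 hg'0
  have hω2 : deriv g 0 = ω ^ 2 := by rw [hωdef, sq_sqrt hg'0.le]
  have hfc : ContDiffAt ℝ 1 f 0 := hf.contDiffAt (Icc_mem_nhds ha hb)
  have hgc : ContDiffAt ℝ 3 g 0 := hg.contDiffAt (Icc_mem_nhds ha hb)
  have hg1 : HasDerivAt (fun x => g x / ω ^ 2 - x) 0 0 :=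
    (((hgc.differentiableAt (by norm_num)).hasDerivAt.div_const (ω ^ 2)).sub
      (hasDerivAt_id 0)).congr_deriv (by rw [hω2, div_self (by positivity), sub_self])
  obtain ⟨K, r, hr, hFG⟩ := exists_smallTerms (F := fun x => f x / ω)
    (G := fun x => g x / ω ^ 2 - x) (hfc.div_const ω)
    (((hgc.of_le (by norm_num)).div_const (ω ^ 2)).sub contDiffAt_id) (by simp [hf0])
    (by simp [hg0]) hg1.deriv
  have hF : (fun x => f x / ω - deriv f 0 / ω * x) =o[nhds 0] fun x => x := by
    have := (hfc.differentiableAt (by norm_num)).hasDerivAt.isLittleO.const_mul_left ω⁻¹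
    simp only [hf0, sub_zero, smul_eq_mul] at this
    exact this.congr_left fun x => by ring
  have hG : (fun x => g x / ω ^ 2 - x - (iteratedDeriv 2 g 0 / ω ^ 2 * x ^ 2 / 2 +
      iteratedDeriv 3 g 0 / ω ^ 2 * x ^ 3 / 6)) =o[nhds 0] fun x => x ^ 3 := by
    refine ((isLittleO_taylor_three ha hb hg).const_mul_left (ω ^ 2)⁻¹).congr_left fun x => ?_
    rw [hg0, hω2]
    field_simp
    ring
  rw [← hωdef, hω2]
  refine Metric.tendsto_nhds.2 fun ε hε => ?_
  filter_upwards [hFG.eventually_abs_period_sub_le hr hF hG (mul_pos hω (half_pos hε)),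
    Ioo_mem_nhdsGT hδ] with c hc hcδ
  obtain ⟨u, hu, hu0, hu1⟩ := hsol c hcδ
  obtain ⟨⟨hT0, hTp⟩, hTmin⟩ := hT c hcδ u hu hu0 hu1
  have hleast : IsLeast {p | 0 < p ∧ ∀ t, u ((t + p) / ω) = u (t / ω)} (ω * T c) := by
    refine ⟨⟨mul_pos hω hT0, fun t => ?_⟩, fun p hp => ?_⟩
    · rw [add_div, mul_div_cancel_left₀ _ hω.ne', hTp]
    · rw [mul_comm, ← le_div_iff₀ hω]
      refine hTmin ⟨div_pos hp.1 hω, fun t => ?_⟩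
      have := hp.2 (t * ω)
      rwa [add_div, mul_div_cancel_right₀ _ hω.ne'] at this
  have hc2 : 0 < c ^ 2 := pow_pos hcδ.1 2
  have h := hc _ _ _ (hu.isFlow hω) (by simpa using hu0) (by simp [hu1]) hleast
  have hc0 := hcδ.1.ne'
  have heq : (T c - 2 * π / ω) / c ^ 2 - -(π / (12 * ω)) *
      (3 / 2 * iteratedDeriv 3 g 0 / ω ^ 2 - 5 / 2 * iteratedDeriv 2 g 0 ^ 2 / (ω ^ 2) ^ 2 -
        deriv f 0 ^ 2 / ω ^ 2) =
      (ω * T c - 2 * π - periodCoeff (deriv f 0 / ω) (iteratedDeriv 2 g 0 / ω ^ 2)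
        (iteratedDeriv 3 g 0 / ω ^ 2) * c ^ 2) / (ω * c ^ 2) := by
    unfold periodCoeff
    field_simp
    ring
  rw [dist_eq, heq, abs_div, abs_of_pos (mul_pos hω hc2), div_lt_iff₀ (mul_pos hω hc2)]
  refine h.trans_lt ?_
  nlinarith [mul_pos (mul_pos hω hc2) hε]
end

section
/- Let f : ℝ → ℝ be C² and g : ℝ → ℝ be C³ on an interval [a,b] containing 0, with f(0) = g(0) = 0, g'(0) > 0, g''(0) = 0 and f''(0) = 0, and suppose the origin is a center of x'' + f(x)x' + g(x) = 0 with period function T. Let C(x) = g(x)/g'(0) − (1/(g'(0)·x³))·(∫₀ˣ s·f(s) ds)² for x ≠ 0, C(0) = 0, and let J be an interval containing 0 on which C is defined and twice differentiable. If C''(x) > 0 for x ∈ J with x < 0 and C''(x) < 0 for x ∈ J with x > 0, then T is increasing on some interval (0,ε); if C''(x) > 0 for x ∈ J with x > 0 and C''(x) < 0 for x ∈ J with x < 0, then T is decreasing on some interval (0,ε). -/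
open Set Real

/-- A nonnegative function with `|h'| ≤ K h` changes by a factor of at most `exp (K |b - a|)`. -/
theorem le_mul_exp_of_abs_deriv_le {h h' : ℝ → ℝ} {s : Set ℝ} (hs : s.OrdConnected) {K : ℝ}
    (hd : ∀ t ∈ s, HasDerivAt h (h' t) t) (hb : ∀ t ∈ s, |h' t| ≤ K * h t) {a b : ℝ}
    (ha : a ∈ s) (hbs : b ∈ s) : h b ≤ h a * exp (K * |b - a|) := by
  have key : ∀ k : ℝ, ∀ t ∈ s, HasDerivAt (fun t => h t * exp (k * t))
      ((h' t + k * h t) * exp (k * t)) t := by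
    intro k t ht
    have h2 : HasDerivAt (fun t : ℝ => exp (k * t)) (exp (k * t) * (k * 1)) t :=
      ((hasDerivAt_id t).const_mul k).exp
    exact ((hd t ht).mul h2).congr_deriv (by ring)
  have hconv : Convex ℝ s := convex_iff_ordConnected.2 hs
  rcases le_total a b with hab | hab
  · have hanti : AntitoneOn (fun t => h t * exp (-K * t)) s := by
      apply antitoneOn_of_hasDerivWithinAt_nonpos hconv
        (fun t ht => (key (-K) t ht).continuousAt.continuousWithinAt)
        (fun t ht => (key (-K) t (interior_subset ht)).hasDerivWithinAt)
      intro t ht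
      have := abs_le.1 (hb t (interior_subset ht))
      exact mul_nonpos_of_nonpos_of_nonneg (by linarith [this.2]) (exp_pos _).le
    have h1 : h b * exp (-K * b) ≤ h a * exp (-K * a) := hanti ha hbs hab
    rw [abs_of_nonneg (by linarith)]
    calc h b = h b * exp (-K * b) * exp (K * b) := by
          rw [mul_assoc, ← exp_add]; simp
      _ ≤ h a * exp (-K * a) * exp (K * b) := by gcongr
      _ = _ := by rw [mul_assoc, ← exp_add]; ring_nf
  · have hmono : MonotoneOn (fun t => h t * exp (K * t)) s := by
      apply monotoneOn_of_hasDerivWithinAt_nonneg hconv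
        (fun t ht => (key K t ht).continuousAt.continuousWithinAt)
        (fun t ht => (key K t (interior_subset ht)).hasDerivWithinAt)
      intro t ht
      have := abs_le.1 (hb t (interior_subset ht))
      exact mul_nonneg (by linarith [this.1]) (exp_pos _).le
    have h1 : h b * exp (K * b) ≤ h a * exp (K * a) := hmono hbs ha hab
    rw [abs_of_nonpos (by linarith)]
    calc h b = h b * exp (K * b) * exp (-K * b) := by
          rw [mul_assoc, ← exp_add]; simp
      _ ≤ h a * exp (K * a) * exp (-K * b) := by gcongr
      _ = _ := by rw [mul_assoc, ← exp_add]; ring_nf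

/-- A continuous function exceeding a level at a nonnegative time reaches it for a first time. -/
theorem exists_first_hitting {E : ℝ → ℝ} (hE : Continuous E) {m : ℝ} (h0 : E 0 < m)
    (h : ∃ t, 0 ≤ t ∧ m ≤ E t) : ∃ t, 0 < t ∧ E t = m ∧ ∀ s, 0 ≤ s → s < t → E s < m := by
  set S : Set ℝ := {t | 0 ≤ t ∧ m ≤ E t}
  have hcl : IsClosed S := isClosed_Ici.inter (isClosed_le continuous_const hE)
  have hbd : BddBelow S := ⟨0, fun t ht => ht.1⟩
  have hmem : sInf S ∈ S := hcl.csInf_mem h hbd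
  have hlt : ∀ s, 0 ≤ s → s < sInf S → E s < m := by
    intro s hs hs'
    by_contra hc
    exact absurd (csInf_le hbd (show s ∈ S from ⟨hs, not_lt.1 hc⟩)) (not_le.2 hs')
  have hpos : 0 < sInf S := by
    rcases hmem.1.eq_or_lt with h1 | h1
    · have := hmem.2
      rw [← h1] at this
      linarith
    · exact h1
  refine ⟨sInf S, hpos, le_antisymm ?_ hmem.2, hlt⟩
  by_contra hc
  obtain ⟨s, hs, hsE⟩ := intermediate_value_Ioo hmem.1 hE.continuousOn ⟨h0, not_le.1 hc⟩
  exact absurd (hlt s hs.1.le hs.2) (by rw [hsE]; exact lt_irrefl m)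

/-- Coefficients of the planar system `x' = ω z - x B(x)`, `z' = -ω x q(x) - z B(x)`, close to
those of the harmonic oscillator. -/
structure NearHarmonic (ω L : ℝ) (B q : ℝ → ℝ) : Prop where
  pos : 0 < ω
  B_zero : B 0 = 0
  B_bound : ∀ x, |B x| ≤ ω / 4
  q_bound : ∀ x, |q x - 1| ≤ 1 / 4
  B_lip : ∀ x y, |B x - B y| ≤ L * |x - y|
  q_lip : ∀ x y, |q x - q y| ≤ L * |x - y|

/-- The angular speed at `(r cos ψ, -r sin ψ)` when the abscissa is `x`. -/
noncomputable def angSpeed (ω : ℝ) (q : ℝ → ℝ) (ψ x : ℝ) : ℝ :=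
  ω * (sin ψ ^ 2 + cos ψ ^ 2 * q x)

/-- The derivative of `log r` with respect to the polar angle. -/
noncomputable def logRadSlope (ω : ℝ) (B q : ℝ → ℝ) (ψ l : ℝ) : ℝ :=
  -(B (exp l * cos ψ) + ω * (sin ψ * cos ψ) * (1 - q (exp l * cos ψ))) /
    angSpeed ω q ψ (exp l * cos ψ)

namespace NearHarmonic

variable {ω L : ℝ} {B q : ℝ → ℝ}

theorem le_angSpeed (H : NearHarmonic ω L B q) (ψ x : ℝ) : 3 * ω / 4 ≤ angSpeed ω q ψ x := by
  have h1 := abs_le.1 (H.q_bound x)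
  have h2 := sin_sq_add_cos_sq ψ
  have h3 : 3 / 4 ≤ sin ψ ^ 2 + cos ψ ^ 2 * q x := by
    nlinarith [sq_nonneg (cos ψ), sq_nonneg (sin ψ)]
  unfold angSpeed
  nlinarith [H.pos]

theorem abs_radial_le (H : NearHarmonic ω L B q) (ψ x : ℝ) :
    |B x + ω * (sin ψ * cos ψ) * (1 - q x)| ≤ 3 * ω / 8 := by
  have h1 := H.q_bound x
  have h2 := H.B_bound x
  have h3 : |sin ψ * cos ψ| ≤ 1 / 2 := by
    rw [abs_le]
    constructor <;> nlinarith [sin_sq_add_cos_sq ψ, sq_nonneg (sin ψ - cos ψ),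
      sq_nonneg (sin ψ + cos ψ)]
  have h4 : |ω * (sin ψ * cos ψ) * (1 - q x)| ≤ ω / 8 := by
    rw [abs_mul, abs_mul, abs_of_pos H.pos, abs_sub_comm 1]
    have := mul_le_mul h3 h1 (abs_nonneg _) (by norm_num)
    nlinarith [H.pos]
  linarith [abs_add_le (B x) (ω * (sin ψ * cos ψ) * (1 - q x))]

theorem abs_logRadSlope_le (H : NearHarmonic ω L B q) (ψ l : ℝ) :
    |logRadSlope ω B q ψ l| ≤ 1 := by
  have h1 := H.le_angSpeed ψ (exp l * cos ψ)
  have h2 := H.pos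
  unfold logRadSlope
  rw [abs_div, abs_neg, abs_of_pos (by linarith : 0 < angSpeed ω q ψ (exp l * cos ψ)),
    div_le_one (by linarith)]
  linarith [H.abs_radial_le ψ (exp l * cos ψ)]

theorem exists_lipschitz_logRadSlope (H : NearHarmonic ω L B q) :
    ∃ K, ∀ ψ l₁ l₂, l₁ ≤ 0 → l₂ ≤ 0 →
      |logRadSlope ω B q ψ l₁ - logRadSlope ω B q ψ l₂| ≤ K * |l₁ - l₂| := by
  have hω := H.pos
  have hL : 0 ≤ L := by simpa using (abs_nonneg _).trans (H.B_lip 1 0)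
  refine ⟨(L + 2 * ω * L) / (3 * ω / 4), ?_⟩
  have hexp : ∀ l₁ l₂ : ℝ, l₁ ≤ l₂ → l₂ ≤ 0 → exp l₂ - exp l₁ ≤ l₂ - l₁ := by
    intro l₁ l₂ h h2
    have h3 := add_one_le_exp (l₁ - l₂)
    have h4 : exp l₁ = exp l₂ * exp (l₁ - l₂) := by rw [← exp_add]; ring_nf
    have h5 : exp l₂ ≤ 1 := exp_le_one_iff.2 h2
    rw [h4]
    nlinarith [exp_pos l₂]
  intro ψ l₁ l₂ h1 h2
  have hx : |exp l₁ * cos ψ - exp l₂ * cos ψ| ≤ |l₁ - l₂| := by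
    rw [← sub_mul, abs_mul]
    have h3 : |exp l₁ - exp l₂| ≤ |l₁ - l₂| := by
      rcases le_total l₁ l₂ with h | h
      · rw [abs_sub_comm, abs_sub_comm l₁, abs_of_nonneg (sub_nonneg.2 h),
          abs_of_nonneg (sub_nonneg.2 (exp_le_exp.2 h))]
        exact hexp _ _ h h2
      · rw [abs_of_nonneg (sub_nonneg.2 h), abs_of_nonneg (sub_nonneg.2 (exp_le_exp.2 h))]
        exact hexp _ _ h h1
    nlinarith [abs_cos_le_one ψ, abs_nonneg (cos ψ), abs_nonneg (exp l₁ - exp l₂)]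
  unfold logRadSlope
  set x₁ := exp l₁ * cos ψ
  set x₂ := exp l₂ * cos ψ
  have hD1 := H.le_angSpeed ψ x₁
  have hD2 := H.le_angSpeed ψ x₂
  have hN2 := H.abs_radial_le ψ x₂
  have hsc : |sin ψ * cos ψ| ≤ 1 := by
    rw [abs_mul]
    exact mul_le_one₀ (abs_sin_le_one ψ) (abs_nonneg _) (abs_cos_le_one ψ)
  have hq : |q x₁ - q x₂| ≤ L * |l₁ - l₂| :=
    (H.q_lip x₁ x₂).trans (mul_le_mul_of_nonneg_left hx hL)
  have hB : |B x₁ - B x₂| ≤ L * |l₁ - l₂| :=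
    (H.B_lip x₁ x₂).trans (mul_le_mul_of_nonneg_left hx hL)
  set N₁ := B x₁ + ω * (sin ψ * cos ψ) * (1 - q x₁) with hN₁
  set N₂ := B x₂ + ω * (sin ψ * cos ψ) * (1 - q x₂) with hN₂
  have hNN : |N₁ - N₂| ≤ (L + ω * L) * |l₁ - l₂| := by
    have : N₁ - N₂ = (B x₁ - B x₂) + -(ω * ((sin ψ * cos ψ) * (q x₁ - q x₂))) := by
      rw [hN₁, hN₂]; ring
    rw [this]
    refine (abs_add_le _ _).trans ?_
    rw [abs_neg, abs_mul, abs_mul, abs_of_pos hω]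
    have h5 : |sin ψ * cos ψ| * |q x₁ - q x₂| ≤ 1 * (L * |l₁ - l₂|) :=
      mul_le_mul hsc hq (abs_nonneg _) (by norm_num)
    nlinarith
  have hDD : |angSpeed ω q ψ x₂ - angSpeed ω q ψ x₁| ≤ ω * L * |l₁ - l₂| := by
    have : angSpeed ω q ψ x₂ - angSpeed ω q ψ x₁ = -(ω * (cos ψ ^ 2 * (q x₁ - q x₂))) := by
      unfold angSpeed; ring
    rw [this, abs_neg, abs_mul, abs_mul, abs_of_pos hω, abs_of_nonneg (sq_nonneg (cos ψ))]
    have h5 : cos ψ ^ 2 * |q x₁ - q x₂| ≤ 1 * (L * |l₁ - l₂|) :=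
      mul_le_mul (cos_sq_le_one ψ) hq (abs_nonneg _) (by norm_num)
    nlinarith
  set D₁ := angSpeed ω q ψ x₁
  set D₂ := angSpeed ω q ψ x₂
  have hD1' : 0 < D₁ := by linarith
  have hD2' : 0 < D₂ := by linarith
  have e : -N₁ / D₁ - -N₂ / D₂ = -((N₁ - N₂) + (N₂ / D₂) * (D₂ - D₁)) / D₁ := by
    field_simp
    ring
  have hND : |N₂ / D₂| ≤ 1 := by
    rw [abs_div, abs_of_pos hD2', div_le_one hD2']
    linarith
  rw [e, abs_div, abs_neg, abs_of_pos hD1', div_mul_eq_mul_div (L + 2 * ω * L)]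
  have h6 : |N₁ - N₂ + N₂ / D₂ * (D₂ - D₁)| ≤ (L + 2 * ω * L) * |l₁ - l₂| := by
    refine (abs_add_le _ _).trans ?_
    rw [abs_mul]
    have := mul_le_mul hND hDD (abs_nonneg _) (by norm_num)
    linarith
  exact div_le_div₀ ((abs_nonneg _).trans h6) h6 (by positivity) hD1

theorem logRadSlope_unique (H : NearHarmonic ω L B q) {s : Set ℝ} (hs : s.OrdConnected)
    {l₁ l₂ : ℝ → ℝ} (h₁ : ∀ ψ ∈ s, HasDerivAt l₁ (logRadSlope ω B q ψ (l₁ ψ)) ψ)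
    (h₂ : ∀ ψ ∈ s, HasDerivAt l₂ (logRadSlope ω B q ψ (l₂ ψ)) ψ)
    (hl₁ : ∀ ψ ∈ s, l₁ ψ ≤ 0) (hl₂ : ∀ ψ ∈ s, l₂ ψ ≤ 0) {a b : ℝ} (ha : a ∈ s) (hb : b ∈ s)
    (hab : l₁ a = l₂ a) : l₁ b = l₂ b := by
  obtain ⟨K, hK⟩ := H.exists_lipschitz_logRadSlope
  have h := le_mul_exp_of_abs_deriv_le (h := fun ψ => (l₁ ψ - l₂ ψ) ^ 2) (K := 2 * K) hs
    (fun ψ hψ => ((h₁ ψ hψ).sub (h₂ ψ hψ)).pow 2) (by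
      intro ψ hψ
      have h3 := hK ψ (l₁ ψ) (l₂ ψ) (hl₁ ψ hψ) (hl₂ ψ hψ)
      simp only [Pi.sub_apply]
      rw [abs_mul, abs_mul]
      norm_num
      rw [← sq_abs (l₁ ψ - l₂ ψ)]
      nlinarith [abs_nonneg (l₁ ψ - l₂ ψ)]) ha hb
  simp only [hab, sub_self] at h
  have h4 : (l₁ b - l₂ b) ^ 2 ≤ 0 := by simpa using h
  exact sub_eq_zero.1 (pow_eq_zero_iff (two_ne_zero)|>.1 (le_antisymm h4 (sq_nonneg _)))

theorem logRadSlope_lt (H : NearHarmonic ω L B q) {s : Set ℝ} (hs : s.OrdConnected)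
    {l₁ l₂ : ℝ → ℝ} (h₁ : ∀ ψ ∈ s, HasDerivAt l₁ (logRadSlope ω B q ψ (l₁ ψ)) ψ)
    (h₂ : ∀ ψ ∈ s, HasDerivAt l₂ (logRadSlope ω B q ψ (l₂ ψ)) ψ)
    (hl₁ : ∀ ψ ∈ s, l₁ ψ ≤ 0) (hl₂ : ∀ ψ ∈ s, l₂ ψ ≤ 0) {a b : ℝ} (ha : a ∈ s) (hb : b ∈ s)
    (hab : l₁ a < l₂ a) : l₁ b < l₂ b := by
  by_contra hc
  obtain ⟨e, he, hee⟩ := hs.isPreconnected.intermediate_value₂ ha hb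
    (fun ψ hψ => (h₁ ψ hψ).continuousAt.continuousWithinAt)
    (fun ψ hψ => (h₂ ψ hψ).continuousAt.continuousWithinAt) hab.le (not_lt.1 hc)
  exact hab.ne (H.logRadSlope_unique hs h₁ h₂ hl₁ hl₂ he ha hee)

theorem logRadSlope_add_two_pi (ψ l : ℝ) :
    logRadSlope ω B q (ψ + 2 * π) l = logRadSlope ω B q ψ l := by
  simp [logRadSlope, angSpeed]

end NearHarmonic

/-- The pair `(x, z)` solves the planar system with coefficients `B`, `q` at all times in `I`. -/
def SolvesOn (ω : ℝ) (B q x z : ℝ → ℝ) (I : Set ℝ) : Prop :=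
  ∀ t ∈ I, HasDerivAt x (ω * z t - x t * B (x t)) t ∧
    HasDerivAt z (-ω * (x t * q (x t)) - z t * B (x t)) t

/-- Polar coordinates along an orbit: `φ` is the angle as a function of time, `τ` its inverse, and
`l` the logarithm of the radius as a function of the angle. -/
structure IsPolar (ω : ℝ) (B q x z : ℝ → ℝ) (I : Set ℝ) (φ τ l : ℝ → ℝ) : Prop where
  expand : ∀ s t, s ≤ t → 3 * ω / 4 * (t - s) ≤ φ t - φ s
  left_inv : ∀ t, τ (φ t) = t
  right_inv : ∀ ψ, φ (τ ψ) = ψ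
  abscissa : ∀ t ∈ I, x t = exp (l (φ t)) * cos (φ t)
  ordinate : ∀ t ∈ I, z t = -(exp (l (φ t)) * sin (φ t))
  deriv_l : ∀ ψ, τ ψ ∈ I → HasDerivAt l (logRadSlope ω B q ψ (l ψ)) ψ
  deriv_τ : ∀ ψ, τ ψ ∈ I →
    HasDerivAt τ (angSpeed ω q ψ (exp (l ψ) * cos ψ))⁻¹ ψ

namespace NearHarmonic

variable {ω L : ℝ} {B q x z : ℝ → ℝ} {I : Set ℝ}

theorem continuous_B (H : NearHarmonic ω L B q) : Continuous B := by
  refine (LipschitzWith.of_dist_le_mul (K := L.toNNReal) fun a b => ?_).continuous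
  have hL : 0 ≤ L := by simpa using (abs_nonneg _).trans (H.B_lip 1 0)
  simpa [Real.dist_eq, hL] using H.B_lip a b

theorem continuous_q (H : NearHarmonic ω L B q) : Continuous q := by
  refine (LipschitzWith.of_dist_le_mul (K := L.toNNReal) fun a b => ?_).continuous
  have hL : 0 ≤ L := by simpa using (abs_nonneg _).trans (H.B_lip 1 0)
  simpa [Real.dist_eq, hL] using H.q_lip a b

theorem abs_energy_rate_le (H : NearHarmonic ω L B q) (x z : ℝ) :
    |-2 * (x ^ 2 + z ^ 2) * B x + 2 * ω * (x * z) * (1 - q x)| ≤ ω * (x ^ 2 + z ^ 2) := by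
  have h1 := H.q_bound x
  have h2 := H.B_bound x
  have h0 := H.pos
  have h3 : |2 * (x * z)| ≤ x ^ 2 + z ^ 2 := by
    rw [abs_le]
    constructor <;> nlinarith [sq_nonneg (x - z), sq_nonneg (x + z)]
  have h4 : |2 * ω * (x * z) * (1 - q x)| ≤ ω * (x ^ 2 + z ^ 2) / 4 := by
    have e : 2 * ω * (x * z) * (1 - q x) = ω * ((2 * (x * z)) * (1 - q x)) := by ring
    rw [e, abs_mul, abs_mul, abs_of_pos h0, abs_sub_comm 1]
    have := mul_le_mul h3 h1 (abs_nonneg _) (by positivity)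
    nlinarith
  have h5 : |-2 * (x ^ 2 + z ^ 2) * B x| ≤ ω * (x ^ 2 + z ^ 2) / 2 := by
    have e : -2 * (x ^ 2 + z ^ 2) * B x = -((2 * (x ^ 2 + z ^ 2)) * B x) := by ring
    rw [e, abs_neg, abs_mul, abs_of_nonneg (by positivity)]
    nlinarith [sq_nonneg x, sq_nonneg z]
  have h6 : 0 ≤ ω * (x ^ 2 + z ^ 2) := by positivity
  linarith [abs_add_le (-2 * (x ^ 2 + z ^ 2) * B x) (2 * ω * (x * z) * (1 - q x))]

theorem hasDerivAt_energy (hxz : SolvesOn ω B q x z I) {t : ℝ} (ht : t ∈ I) :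
    HasDerivAt (fun t => x t ^ 2 + z t ^ 2)
      (-2 * (x t ^ 2 + z t ^ 2) * B (x t) + 2 * ω * (x t * z t) * (1 - q (x t))) t := by
  exact (((hxz t ht).1.pow 2).add ((hxz t ht).2.pow 2)).congr_deriv (by push_cast; ring)

theorem energy_le (H : NearHarmonic ω L B q) (hI : I.OrdConnected) (hxz : SolvesOn ω B q x z I)
    {a b : ℝ} (ha : a ∈ I) (hb : b ∈ I) :
    x b ^ 2 + z b ^ 2 ≤ (x a ^ 2 + z a ^ 2) * exp (ω * |b - a|) :=
  le_mul_exp_of_abs_deriv_le (h := fun t => x t ^ 2 + z t ^ 2) hI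
    (fun _ ht => hasDerivAt_energy hxz ht) (fun t _ => H.abs_energy_rate_le (x t) (z t)) ha hb

theorem exists_polar (H : NearHarmonic ω L B q) (hI : I.OrdConnected) {pr : ℝ → ℝ}
    (hpr : Continuous pr) (hprI : ∀ t, pr t ∈ I) (hprid : ∀ t ∈ I, pr t = t) (h0 : 0 ∈ I)
    (hxz : SolvesOn ω B q x z I) {r₀ φ₀ : ℝ} (hr₀ : 0 < r₀) (hx0 : x 0 = r₀ * cos φ₀)
    (hz0 : z 0 = -(r₀ * sin φ₀)) :
    ∃ φ τ l : ℝ → ℝ, φ 0 = φ₀ ∧ IsPolar ω B q x z I φ τ l := by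
  have hω := H.pos
  have hE0 : x 0 ^ 2 + z 0 ^ 2 = r₀ ^ 2 := by
    rw [hx0, hz0]; linear_combination r₀ ^ 2 * sin_sq_add_cos_sq φ₀
  have hE : ∀ t ∈ I, 0 < x t ^ 2 + z t ^ 2 := by
    intro t ht
    have h1 := H.energy_le hI hxz ht h0
    rw [hE0] at h1
    by_contra hc
    nlinarith [exp_pos (ω * |0 - t|), pow_pos hr₀ 2]
  have hxc : ContinuousOn x I := fun t ht => (hxz t ht).1.continuousAt.continuousWithinAt
  have hzc : ContinuousOn z I := fun t ht => (hxz t ht).2.continuousAt.continuousWithinAt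
  set w : ℝ → ℝ := fun t => ω * (z t ^ 2 + x t ^ 2 * q (x t)) / (x t ^ 2 + z t ^ 2) with hw
  have hwc : Continuous fun t => w (pr t) := by
    have : ContinuousOn w I := by
      refine ContinuousOn.div ?_ ((hxc.pow 2).add (hzc.pow 2)) fun t ht => (hE t ht).ne'
      exact continuousOn_const.mul ((hzc.pow 2).add ((hxc.pow 2).mul
        (H.continuous_q.comp_continuousOn hxc)))
    exact this.comp_continuous hpr hprI
  have hwlow : ∀ t ∈ I, 3 * ω / 4 ≤ w t := by
    intro t ht
    rw [hw]
    simp only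
    rw [le_div_iff₀ (hE t ht)]
    have h1 := (abs_le.1 (H.q_bound (x t))).1
    have h2 : 3 / 4 * (x t ^ 2 + z t ^ 2) ≤ z t ^ 2 + x t ^ 2 * q (x t) := by
      nlinarith [sq_nonneg (x t), sq_nonneg (z t)]
    nlinarith
  set φ : ℝ → ℝ := fun t => φ₀ + ∫ s in (0:ℝ)..t, w (pr s) with hφ
  have hφ0 : φ 0 = φ₀ := by simp [hφ]
  have hφd : ∀ t, HasDerivAt φ (w (pr t)) t := fun t =>
    (intervalIntegral.integral_hasDerivAt_right (hwc.intervalIntegrable _ _)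
      (hwc.stronglyMeasurableAtFilter _ _) hwc.continuousAt).const_add φ₀
  have hexpand : ∀ s t, s ≤ t → 3 * ω / 4 * (t - s) ≤ φ t - φ s := by
    intro s t hst
    exact convex_univ.mul_sub_le_image_sub_of_le_deriv
      (fun t _ => (hφd t).continuousAt.continuousWithinAt)
      (fun t _ => (hφd t).differentiableAt.differentiableWithinAt)
      (fun t _ => by rw [(hφd t).deriv]; exact hwlow _ (hprI t)) s trivial t trivial hst
  have hmono : StrictMono φ := by
    intro s t hst
    have := hexpand s t hst.le
    nlinarith [mul_pos hω (sub_pos.2 hst)]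
  have hφc : Continuous φ := continuous_iff_continuousAt.2 fun t => (hφd t).continuousAt
  have hsurj : Function.Surjective φ := by
    apply hφc.surjective
    · refine Filter.tendsto_atTop_mono' _ ?_
        ((Filter.tendsto_id.const_mul_atTop (by positivity : 0 < 3 * ω / 4)).atTop_add
          (tendsto_const_nhds (x := φ₀)))
      filter_upwards [Filter.eventually_ge_atTop 0] with t ht
      have := hexpand 0 t ht
      simp only [id]
      linarith
    · refine Filter.tendsto_atBot_mono' _ ?_
        ((Filter.tendsto_id.const_mul_atBot (by positivity : 0 < 3 * ω / 4)).atBot_add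
          (tendsto_const_nhds (x := φ₀)))
      filter_upwards [Filter.eventually_le_atBot 0] with t ht
      have := hexpand t 0 ht
      simp only [id]
      linarith
  set e : ℝ ≃o ℝ := hmono.orderIsoOfSurjective φ hsurj with he
  set τ : ℝ → ℝ := fun ψ => e.symm ψ with hτ
  have hl : ∀ t, τ (φ t) = t := fun t => e.symm_apply_apply t
  have hr : ∀ ψ, φ (τ ψ) = ψ := fun ψ => e.apply_symm_apply ψ
  have hτd : ∀ ψ, HasDerivAt τ (w (pr (τ ψ)))⁻¹ ψ := fun ψ =>
    HasDerivAt.of_local_left_inverse e.symm.continuous.continuousAt (hφd (τ ψ))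
      (by linarith [hwlow _ (hprI (τ ψ))]) (Filter.Eventually.of_forall hr)
  set m : ℝ → ℝ := fun t => log (x t ^ 2 + z t ^ 2) / 2 with hm
  set m' : ℝ → ℝ := fun t => -B (x t) + ω * (x t * z t) * (1 - q (x t)) /
    (x t ^ 2 + z t ^ 2) with hm'
  have hmd : ∀ t ∈ I, HasDerivAt m (m' t) t := by
    intro t ht
    refine (((hasDerivAt_energy hxz ht).log (hE t ht).ne').div_const 2).congr_deriv ?_
    have := (hE t ht).ne'
    rw [hm']
    field_simp
  have hm0 : exp (m 0) = r₀ := by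
    rw [hm]
    simp only
    rw [hE0, log_pow]
    push_cast
    rw [mul_div_cancel_left₀ _ two_ne_zero, exp_log hr₀]
  have hpolar : ∀ t ∈ I, x t = exp (m t) * cos (φ t) ∧ z t = -(exp (m t) * sin (φ t)) := by
    have key : ∀ t ∈ I, HasDerivAt
        (fun t => (x t - exp (m t) * cos (φ t)) ^ 2 + (z t + exp (m t) * sin (φ t)) ^ 2)
        (2 * m' t * ((x t - exp (m t) * cos (φ t)) ^ 2 + (z t + exp (m t) * sin (φ t)) ^ 2)) t := by
      intro t ht
      have hp : pr t = t := hprid t ht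
      have hφt := hφd t
      rw [hp] at hφt
      have hme := (hmd t ht).exp
      refine ((((hxz t ht).1.sub (hme.mul hφt.cos)).pow 2).add
        (((hxz t ht).2.add (hme.mul hφt.sin)).pow 2)).congr_deriv ?_
      have hEt := (hE t ht).ne'
      have e1 : ω * z t - x t * B (x t) = m' t * x t + w t * z t := by
        rw [hm', hw]; field_simp; ring
      have e2 : -ω * (x t * q (x t)) - z t * B (x t) = m' t * z t - w t * x t := by
        rw [hm', hw]; field_simp; ring
      simp only [Pi.sub_apply, Pi.add_apply, Pi.mul_apply]
      rw [e1, e2]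
      push_cast
      ring
    intro t ht
    have h1 := le_mul_exp_of_abs_deriv_le hI key (K := ω) (by
      intro t ht
      rw [abs_mul, abs_of_nonneg (by positivity : 0 ≤ (x t - exp (m t) * cos (φ t)) ^ 2 +
        (z t + exp (m t) * sin (φ t)) ^ 2)]
      refine mul_le_mul_of_nonneg_right ?_ (by positivity)
      have h2 := H.abs_energy_rate_le (x t) (z t)
      have e3 : 2 * m' t = (-2 * (x t ^ 2 + z t ^ 2) * B (x t) +
          2 * ω * (x t * z t) * (1 - q (x t))) / (x t ^ 2 + z t ^ 2) := by
        have := (hE t ht).ne'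
        rw [hm']; field_simp
      rw [e3, abs_div, abs_of_pos (hE t ht), div_le_iff₀ (hE t ht)]
      exact h2) h0 ht
    rw [hm0, hφ0, hx0, hz0] at h1
    have h2 : (x t - exp (m t) * cos (φ t)) ^ 2 + (z t + exp (m t) * sin (φ t)) ^ 2 ≤ 0 := by
      simpa using h1
    constructor
    · nlinarith [sq_nonneg (x t - exp (m t) * cos (φ t)), sq_nonneg (z t + exp (m t) * sin (φ t))]
    · nlinarith [sq_nonneg (x t - exp (m t) * cos (φ t)), sq_nonneg (z t + exp (m t) * sin (φ t))]
  have hEm : ∀ t ∈ I, x t ^ 2 + z t ^ 2 = exp (m t) ^ 2 := by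
    intro t ht
    rw [(hpolar t ht).1, (hpolar t ht).2]
    linear_combination exp (m t) ^ 2 * sin_sq_add_cos_sq (φ t)
  have hwD : ∀ ψ, τ ψ ∈ I → w (τ ψ) = angSpeed ω q ψ (exp (m (τ ψ)) * cos ψ) := by
    intro ψ hψ
    have h1 := (hpolar _ hψ).1
    have h2 := (hpolar _ hψ).2
    rw [hr ψ] at h1 h2
    rw [← h1, hw, angSpeed]
    simp only
    rw [hEm _ hψ, div_eq_iff (by positivity)]
    have h3 : z (τ ψ) ^ 2 = exp (m (τ ψ)) ^ 2 * sin ψ ^ 2 := by rw [h2]; ring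
    have h4 : x (τ ψ) ^ 2 = exp (m (τ ψ)) ^ 2 * cos ψ ^ 2 := by
      conv_lhs => rw [h1]
      ring
    rw [h3, h4]
    ring
  refine ⟨φ, τ, m ∘ τ, hφ0, hexpand, hl, hr, ?_, ?_, ?_, ?_⟩
  · intro t ht
    simpa [hl] using (hpolar t ht).1
  · intro t ht
    simpa [hl] using (hpolar t ht).2
  · intro ψ hψ
    refine ((hmd _ hψ).comp ψ (hτd ψ)).congr_deriv ?_
    rw [hprid _ hψ, hwD ψ hψ, logRadSlope, ← div_eq_mul_inv]
    congr 1
    have h1 := (hpolar _ hψ).1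
    have h2 := (hpolar _ hψ).2
    rw [hr ψ] at h1 h2
    simp only [Function.comp]
    rw [← h1, hm']
    simp only
    rw [hEm _ hψ]
    have h4 : x (τ ψ) * z (τ ψ) = -(exp (m (τ ψ)) ^ 2 * (sin ψ * cos ψ)) := by
      rw [h2]
      conv_lhs => rw [h1]
      ring
    rw [h4]
    field_simp
    ring
  · intro ψ hψ
    have := hτd ψ
    rwa [hprid _ hψ, hwD ψ hψ] at this

end NearHarmonic

namespace IsPolar

variable {ω L : ℝ} {B q x z φ τ l : ℝ → ℝ} {I : Set ℝ}

theorem energy (P : IsPolar ω B q x z I φ τ l) {t : ℝ} (ht : t ∈ I) :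
    x t ^ 2 + z t ^ 2 = exp (l (φ t)) ^ 2 := by
  rw [P.abscissa t ht, P.ordinate t ht]
  linear_combination exp (l (φ t)) ^ 2 * sin_sq_add_cos_sq (φ t)

theorem le_of_le (P : IsPolar ω B q x z I φ τ l) (hω : 0 < ω) {s t : ℝ} (h : φ s ≤ φ t) :
    s ≤ t := by
  by_contra hc
  have := P.expand t s (not_le.1 hc).le
  nlinarith [mul_pos hω (sub_pos.2 (not_le.1 hc))]

theorem lt_of_lt (P : IsPolar ω B q x z I φ τ l) (hω : 0 < ω) {s t : ℝ} (h : φ s < φ t) :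
    s < t :=
  (P.le_of_le hω h.le).lt_of_ne fun e => h.ne (congrArg φ e)

/-- Along an orbit with period `p`, the angle gains at least one turn per period. -/
theorem exists_turns (P : IsPolar ω B q x z univ φ τ l) (hω : 0 < ω) {p : ℝ} (hp : 0 < p)
    (hpx : ∀ t, x (t + p) = x t) (hpz : ∀ t, z (t + p) = z t) :
    ∃ k : ℕ, 0 < k ∧ φ p = φ 0 + k * (2 * π) ∧ l (φ p) = l (φ 0) := by
  have hx : x p = x 0 := by simpa using hpx 0
  have hz : z p = z 0 := by simpa using hpz 0
  have hl : exp (l (φ p)) = exp (l (φ 0)) := by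
    have h1 := P.energy (mem_univ p)
    rw [hx, hz, P.energy (mem_univ 0)] at h1
    exact ((pow_left_inj₀ (exp_pos _).le (exp_pos _).le two_ne_zero).1 h1).symm
  rw [P.abscissa p trivial, P.abscissa 0 trivial, hl] at hx
  rw [P.ordinate p trivial, P.ordinate 0 trivial, hl] at hz
  have hcos : cos (φ p) = cos (φ 0) := mul_left_cancel₀ (exp_pos _).ne' hx
  have hsin : sin (φ p) = sin (φ 0) := mul_left_cancel₀ (exp_pos _).ne' (neg_injective hz)
  obtain ⟨k, hk⟩ := Real.Angle.angle_eq_iff_two_pi_dvd_sub.1 (Real.Angle.cos_sin_inj hcos hsin)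
  have h2 := P.expand 0 p hp.le
  have hk0 : 0 < k := by
    have h3 : 0 < 2 * π * k := by
      rw [← hk]
      nlinarith [mul_pos hω hp]
    have h4 : (0 : ℝ) < k := (mul_pos_iff_of_pos_left (by positivity)).1 h3
    exact_mod_cast h4
  lift k to ℕ using hk0.le
  refine ⟨k, by exact_mod_cast hk0, ?_, exp_injective hl⟩
  push_cast at hk
  linarith

theorem l_add_two_pi (P : IsPolar ω B q x z univ φ τ l) (H : NearHarmonic ω L B q)
    (hl : ∀ ψ, l ψ ≤ 0) {p : ℝ} (hp : 0 < p) (hpx : ∀ t, x (t + p) = x t)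
    (hpz : ∀ t, z (t + p) = z t) (ψ : ℝ) : l (ψ + 2 * π) = l ψ := by
  obtain ⟨k, hk, hφ, hlk⟩ := P.exists_turns H.pos hp hpx hpz
  have h₁ : ∀ ψ ∈ univ, HasDerivAt l (logRadSlope ω B q ψ (l ψ)) ψ :=
    fun ψ _ => P.deriv_l ψ trivial
  have h₂ : ∀ ψ ∈ univ, HasDerivAt (fun ψ => l (ψ + 2 * π))
      (logRadSlope ω B q ψ (l (ψ + 2 * π))) ψ := by
    intro ψ _
    have := (h₁ (ψ + 2 * π) trivial).comp_add_const ψ (2 * π)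
    rwa [NearHarmonic.logRadSlope_add_two_pi] at this
  set a : ℕ → ℝ := fun n => l (φ 0 + n * (2 * π)) with ha
  have hsucc : ∀ n, a (n + 1) = l (φ 0 + n * (2 * π) + 2 * π) := by
    intro n
    simp only [ha]
    congr 1
    push_cast
    ring
  have hak : a k = a 0 := by simp [ha, ← hφ, hlk]
  rcases lt_trichotomy (l (φ 0 + 2 * π)) (l (φ 0)) with h | h | h
  · have : StrictAnti a := strictAnti_nat_of_succ_lt fun n => by
      rw [hsucc]
      exact H.logRadSlope_lt ordConnected_univ h₂ h₁ (fun _ _ => hl _) (fun _ _ => hl _)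
        (mem_univ (φ 0)) (mem_univ _) h
    exact absurd hak (this hk).ne
  · exact H.logRadSlope_unique ordConnected_univ h₂ h₁ (fun _ _ => hl _) (fun _ _ => hl _)
      (mem_univ (φ 0)) (mem_univ ψ) h
  · have : StrictMono a := strictMono_nat_of_lt_succ fun n => by
      rw [hsucc]
      exact H.logRadSlope_lt ordConnected_univ h₁ h₂ (fun _ _ => hl _) (fun _ _ => hl _)
        (mem_univ (φ 0)) (mem_univ _) h
    exact absurd hak (this hk).ne'

theorem exists_isLeast_period (P : IsPolar ω B q x z univ φ τ l) (H : NearHarmonic ω L B q)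
    (hl : ∀ ψ, l ψ ≤ 0) {p : ℝ} (hp : 0 < p) (hpx : ∀ t, x (t + p) = x t)
    (hpz : ∀ t, z (t + p) = z t) :
    ∃ s, (∀ ψ, τ (ψ + 2 * π) = τ ψ + s) ∧
      IsLeast {p | 0 < p ∧ (∀ t, x (t + p) = x t) ∧ ∀ t, z (t + p) = z t} s := by
  have hper := P.l_add_two_pi H hl hp hpx hpz
  have hd : ∀ ψ, HasDerivAt (fun ψ => τ (ψ + 2 * π) - τ ψ) 0 ψ := by
    intro ψ
    have h1 := (P.deriv_τ (ψ + 2 * π) trivial).comp_add_const ψ (2 * π)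
    refine (h1.sub (P.deriv_τ ψ trivial)).congr_deriv ?_
    rw [hper ψ, cos_add_two_pi, sub_eq_zero]
    simp [angSpeed]
  have hconst : ∀ ψ, τ (ψ + 2 * π) = τ ψ + (τ (0 + 2 * π) - τ 0) := by
    intro ψ
    have := is_const_of_deriv_eq_zero (fun ψ => (hd ψ).differentiableAt)
      (fun ψ => (hd ψ).deriv) ψ 0
    linarith
  have hshift : ∀ t, φ (t + (τ (0 + 2 * π) - τ 0)) = φ t + 2 * π := by
    intro t
    have h := hconst (φ t)
    rw [P.left_inv] at h
    rw [← h, P.right_inv]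
  refine ⟨_, hconst, ⟨?_, ?_, ?_⟩, ?_⟩
  · rw [sub_pos]
    apply P.lt_of_lt H.pos
    rw [P.right_inv, P.right_inv]
    linarith [pi_pos]
  · intro t
    rw [P.abscissa _ trivial, P.abscissa t trivial, hshift, hper, cos_add_two_pi]
  · intro t
    rw [P.ordinate _ trivial, P.ordinate t trivial, hshift, hper, sin_add_two_pi]
  · rintro p' ⟨hp', hx', hz'⟩
    obtain ⟨k, hk, hφ, -⟩ := P.exists_turns H.pos hp' hx' hz'
    apply P.le_of_le H.pos
    have h1 := hshift 0
    rw [zero_add] at h1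
    rw [h1, hφ]
    have : (1 : ℝ) ≤ k := by exact_mod_cast hk
    nlinarith [pi_pos]

theorem period_le {x₂ z₂ φ₂ τ₂ l₂ : ℝ → ℝ} (P : IsPolar ω B q x z univ φ τ l)
    (P₂ : IsPolar ω B q x₂ z₂ univ φ₂ τ₂ l₂) (H : NearHarmonic ω L B q) {s s₂ : ℝ}
    (hs : ∀ ψ, τ (ψ + 2 * π) = τ ψ + s) (hs₂ : ∀ ψ, τ₂ (ψ + 2 * π) = τ₂ ψ + s₂)
    (hD : ∀ ψ, angSpeed ω q ψ (exp (l₂ ψ) * cos ψ) ≤ angSpeed ω q ψ (exp (l ψ) * cos ψ)) :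
    s ≤ s₂ := by
  have hmono : Monotone fun ψ => τ₂ ψ - τ ψ := by
    refine monotone_of_hasDerivAt_nonneg
      (fun ψ => (P₂.deriv_τ ψ trivial).sub (P.deriv_τ ψ trivial)) fun ψ => ?_
    have h1 := H.le_angSpeed ψ (exp (l₂ ψ) * cos ψ)
    exact sub_nonneg.2 (inv_anti₀ (by linarith [H.pos]) (hD ψ))
  have := hmono (show (0:ℝ) ≤ 0 + 2 * π by linarith [pi_pos])
  simp only [hs, hs₂] at this
  linarith

end IsPolar

theorem abs_sub_le_of_abs_deriv_le_one {h h' : ℝ → ℝ} (hd : ∀ t, HasDerivAt h (h' t) t)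
    (hb : ∀ t, |h' t| ≤ 1) (a b : ℝ) : |h b - h a| ≤ |b - a| := by
  simpa using convex_univ.norm_image_sub_le_of_norm_hasDerivWithin_le
    (fun t _ => (hd t).hasDerivWithinAt) (fun t _ => hb t) (mem_univ a) (mem_univ b)

namespace NearHarmonic

variable {ω L : ℝ} {B q x z : ℝ → ℝ}

/-- A periodic orbit starting close to the origin stays close to the origin. -/
theorem energy_lt (H : NearHarmonic ω L B q) (hx : Continuous x) (hz : Continuous z) {R : ℝ}
    (hR : 0 < R) (hR1 : R ≤ 1) (hxz : SolvesOn ω B q x z {t | x t ^ 2 + z t ^ 2 ≤ R ^ 2})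
    {p : ℝ} (hp : 0 < p) (hpx : ∀ t, x (t + p) = x t) (hpz : ∀ t, z (t + p) = z t)
    {r₀ φ₀ : ℝ} (hr₀ : 0 < r₀) (hx0 : x 0 = r₀ * cos φ₀) (hz0 : z 0 = -(r₀ * sin φ₀))
    (hsmall : r₀ ^ 2 * exp (4 * π) < R ^ 2) (t : ℝ) : x t ^ 2 + z t ^ 2 < R ^ 2 := by
  by_contra hc
  have hω := H.pos
  set E : ℝ → ℝ := fun t => x t ^ 2 + z t ^ 2 with hEdef
  have hEc : Continuous E := (hx.pow 2).add (hz.pow 2)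
  have hE0 : E 0 = r₀ ^ 2 := by
    simp only [hEdef, hx0, hz0]
    linear_combination r₀ ^ 2 * sin_sq_add_cos_sq φ₀
  have hE0' : E 0 < R ^ 2 := by
    rw [hE0]
    have : 1 ≤ exp (4 * π) := one_le_exp (by positivity)
    nlinarith [pow_pos hr₀ 2]
  have hper : Function.Periodic E p := fun t => by simp only [hEdef, hpx, hpz]
  obtain ⟨tp, htp, hEp, hltp⟩ := exists_first_hitting hEc hE0' (by
    obtain ⟨y, hy, hy'⟩ := hper.exists_mem_Ico₀ hp t
    exact ⟨y, hy.1, by rw [← hy']; exact not_lt.1 hc⟩)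
  obtain ⟨tn, htn, hEn, hltn⟩ := exists_first_hitting (E := fun t => E (-t))
    (hEc.comp continuous_neg) (by simpa using hE0') (by
    obtain ⟨y, hy, hy'⟩ := hper.exists_mem_Ico hp t (-p)
    have h1 := hy.2
    exact ⟨-y, by linarith, by rw [neg_neg, ← hy']; exact not_lt.1 hc⟩)
  have hint : ∀ t, -tn < t → t < tp → E t < R ^ 2 := by
    intro t h1 h2
    rcases le_total 0 t with h | h
    · exact hltp t h h2
    · simpa using hltn (-t) (by linarith) (by linarith)
  have hle : ∀ t ∈ Icc (-tn) tp, E t ≤ R ^ 2 := by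
    intro t ht
    rcases ht.1.eq_or_lt with h | h
    · rw [← h]; exact hEn.le
    rcases ht.2.eq_or_lt with h' | h'
    · rw [h']; exact hEp.le
    exact (hint t h h').le
  have hab : -tn ≤ tp := by linarith
  have hsol : SolvesOn ω B q x z (Icc (-tn) tp) := fun t ht => hxz t (hle t ht)
  obtain ⟨φ, τ, l, -, P⟩ := H.exists_polar ordConnected_Icc
    (pr := fun t => (projIcc (-tn) tp hab t : ℝ)) (continuous_subtype_val.comp continuous_projIcc)
    (fun t => (projIcc (-tn) tp hab t).2) (fun t ht => by rw [projIcc_of_mem hab ht])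
    ⟨by linarith, htp.le⟩ hsol hr₀ hx0 hz0
  have htp4 : 4 * π < ω * tp := by
    by_contra hc4
    have h1 := H.energy_le ordConnected_Icc hsol (a := 0) (b := tp) ⟨by linarith, htp.le⟩
      ⟨hab, le_rfl⟩
    change E tp ≤ E 0 * _ at h1
    rw [hEp, hE0, sub_zero, abs_of_pos htp] at h1
    have h2 : exp (ω * tp) ≤ exp (4 * π) := exp_le_exp.2 (not_lt.1 hc4)
    nlinarith [pow_pos hr₀ 2]
  have hgain : 2 * π < φ tp - φ (-tn) := by
    have := P.expand (-tn) tp hab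
    nlinarith [pi_pos, mul_pos hω htn]
  have hmem : ∀ ψ, φ (-tn) ≤ ψ → ψ ≤ φ tp → τ ψ ∈ Icc (-tn) tp := by
    intro ψ h1 h2
    exact ⟨P.le_of_le hω (by rwa [P.right_inv]), P.le_of_le hω (by rwa [P.right_inv])⟩
  have hlE : ∀ ψ, φ (-tn) ≤ ψ → ψ ≤ φ tp → exp (l ψ) ^ 2 = E (τ ψ) := by
    intro ψ h1 h2
    have := P.energy (hmem ψ h1 h2)
    rw [P.right_inv] at this
    exact this.symm
  have hl0 : ∀ ψ, φ (-tn) ≤ ψ → ψ ≤ φ tp → l ψ ≤ 0 := by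
    intro ψ h1 h2
    rw [← exp_le_one_iff]
    have h3 := hlE ψ h1 h2
    have h4 := hle _ (hmem ψ h1 h2)
    nlinarith [exp_pos (l ψ)]
  have hcmp : l (φ (-tn) + 2 * π) < l (φ (-tn)) := by
    rw [← exp_lt_exp]
    refine lt_of_pow_lt_pow_left₀ 2 (exp_pos _).le ?_
    have h2π := pi_pos
    rw [hlE _ le_rfl (by linarith), hlE _ (by linarith) (by linarith), P.left_inv, hEn]
    exact hint _ (P.lt_of_lt hω (by rw [P.right_inv]; linarith))
      (P.lt_of_lt hω (by rw [P.right_inv]; linarith))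
  have h2π := pi_pos
  have hfin : l (φ tp - 2 * π + 2 * π) < l (φ tp - 2 * π) := by
    refine H.logRadSlope_lt (s := Icc (φ (-tn)) (φ tp - 2 * π)) ordConnected_Icc
      (l₁ := fun ψ => l (ψ + 2 * π)) (l₂ := l) ?_ ?_ ?_ ?_ (a := φ (-tn)) ⟨le_rfl, by linarith⟩
      ⟨by linarith, le_rfl⟩ hcmp
    · intro ψ hψ
      have := (P.deriv_l (ψ + 2 * π) (hmem _ (by linarith [hψ.1]) (by linarith [hψ.2]))
        ).comp_add_const ψ (2 * π)
      rwa [logRadSlope_add_two_pi] at this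
    · intro ψ hψ
      exact P.deriv_l ψ (hmem _ hψ.1 (by linarith [hψ.2]))
    · intro ψ hψ
      exact hl0 _ (by linarith [hψ.1]) (by linarith [hψ.2])
    · intro ψ hψ
      exact hl0 _ hψ.1 (by linarith [hψ.2])
  rw [sub_add_cancel, ← exp_lt_exp] at hfin
  have h3 := pow_lt_pow_left₀ hfin (exp_pos _).le two_ne_zero
  rw [hlE _ (by linarith) le_rfl, hlE _ (by linarith) (by linarith), P.left_inv, hEp] at h3
  exact absurd (hle _ (hmem _ (by linarith) (by linarith))) (not_le.2 h3)

/-- Orbits starting at `(c, c B(c) / ω)` are ordered as the values of `c`. -/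
theorem logRad_lt (H : NearHarmonic ω L B q) {x₁ z₁ φ₁ τ₁ l₁ x₂ z₂ φ₂ τ₂ l₂ : ℝ → ℝ}
    (P₁ : IsPolar ω B q x₁ z₁ univ φ₁ τ₁ l₁) (P₂ : IsPolar ω B q x₂ z₂ univ φ₂ τ₂ l₂)
    (hl₁ : ∀ ψ, l₁ ψ ≤ 0) (hl₂ : ∀ ψ, l₂ ψ ≤ 0) {c₁ c₂ : ℝ} (hc₁ : 0 < c₁) (hc : c₁ < c₂)
    (hcL : 2 * L * c₂ < ω) (hx₁ : x₁ 0 = c₁) (hz₁ : z₁ 0 = c₁ * (B c₁ / ω))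
    (hx₂ : x₂ 0 = c₂) (hz₂ : z₂ 0 = c₂ * (B c₂ / ω)) (hφ₁ : φ₁ 0 = -arctan (B c₁ / ω))
    (hφ₂ : φ₂ 0 = -arctan (B c₂ / ω)) (ψ : ℝ) : l₁ ψ < l₂ ψ := by
  have hω := H.pos
  have hc₂ : 0 < c₂ := hc₁.trans hc
  refine H.logRadSlope_lt ordConnected_univ (fun ψ _ => P₁.deriv_l ψ trivial)
    (fun ψ _ => P₂.deriv_l ψ trivial) (fun _ _ => hl₁ _) (fun _ _ => hl₂ _)
    (mem_univ (φ₂ 0)) (mem_univ ψ) ?_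
  set β₁ := B c₁ / ω with hβ₁
  set β₂ := B c₂ / ω with hβ₂
  have hβ : |β₂ - β₁| ≤ L / ω * (c₂ - c₁) := by
    rw [hβ₁, hβ₂, ← sub_div, abs_div, abs_of_pos hω, div_mul_eq_mul_div]
    have := H.B_lip c₂ c₁
    rw [abs_of_pos (sub_pos.2 hc)] at this
    gcongr
  have hl : ∀ {l c β : ℝ}, 0 < c → c ^ 2 + (c * β) ^ 2 = exp l ^ 2 →
      l = log c + log (1 + β ^ 2) / 2 := by
    intro l c β hc h
    have h1 : c ^ 2 * (1 + β ^ 2) = exp l ^ 2 := by rw [← h]; ring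
    have h2 := congrArg log h1
    rw [log_mul (by positivity) (by positivity), log_pow, log_pow, log_exp] at h2
    push_cast at h2
    linarith
  have e₁ : l₁ (φ₁ 0) = log c₁ + log (1 + β₁ ^ 2) / 2 :=
    hl hc₁ (by rw [← P₁.energy (mem_univ 0), hx₁, hz₁])
  have e₂ : l₂ (φ₂ 0) = log c₂ + log (1 + β₂ ^ 2) / 2 :=
    hl hc₂ (by rw [← P₂.energy (mem_univ 0), hx₂, hz₂])
  have h1 : |l₁ (φ₂ 0) - l₁ (φ₁ 0)| ≤ |φ₂ 0 - φ₁ 0| :=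
    abs_sub_le_of_abs_deriv_le_one (fun ψ => P₁.deriv_l ψ trivial)
      (fun ψ => H.abs_logRadSlope_le ψ _) _ _
  have h2 : |φ₂ 0 - φ₁ 0| ≤ |β₂ - β₁| := by
    rw [hφ₁, hφ₂, ← neg_sub', abs_neg]
    refine abs_sub_le_of_abs_deriv_le_one hasDerivAt_arctan (fun t => ?_) _ _
    rw [abs_of_pos (by positivity), div_le_one (by positivity)]
    nlinarith [sq_nonneg t]
  have h3 : |log (1 + β₂ ^ 2) / 2 - log (1 + β₁ ^ 2) / 2| ≤ |β₂ - β₁| := by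
    refine abs_sub_le_of_abs_deriv_le_one (h := fun t => log (1 + t ^ 2) / 2)
      (fun t => ((((hasDerivAt_id t).pow 2).const_add 1).log
        (by simp only [id, Pi.pow_apply]; positivity)).div_const 2) (fun t => ?_) _ _
    simp only [id, Pi.pow_apply]
    rw [div_div, abs_div, abs_of_pos (by positivity : 0 < (1 + t ^ 2) * 2),
      div_le_one (by positivity), abs_le]
    push_cast
    constructor <;> nlinarith [sq_nonneg (t - 1), sq_nonneg (t + 1)]
  have h4 : (c₂ - c₁) / c₂ ≤ log c₂ - log c₁ := by
    have h5 := log_le_sub_one_of_pos (div_pos hc₁ hc₂)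
    rw [log_div hc₁.ne' hc₂.ne'] at h5
    rw [sub_div, div_self hc₂.ne']
    linarith
  have h6 : 2 * (L / ω * (c₂ - c₁)) < (c₂ - c₁) / c₂ := by
    rw [lt_div_iff₀ hc₂]
    have e : 2 * (L / ω * (c₂ - c₁)) * c₂ = (2 * L * c₂) / ω * (c₂ - c₁) := by ring
    rw [e]
    exact mul_lt_of_lt_one_left (sub_pos.2 hc) ((div_lt_one hω).2 hcL)
  have h7 := abs_le.1 (h1.trans h2)
  have h8 := abs_le.1 h3
  linarith [h7.2, h8.1]

end NearHarmonic

theorem exists_abs_sub_le_of_contDiffAt {h : ℝ → ℝ} (hh : ContDiffAt ℝ 1 h 0) :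
    ∃ K r : ℝ, 0 ≤ K ∧ 0 < r ∧ ∀ x y, |x| ≤ r → |y| ≤ r → |h x - h y| ≤ K * |x - y| := by
  obtain ⟨K, t, ht, hK⟩ := hh.exists_lipschitzOnWith
  obtain ⟨r, hr, hrt⟩ := Metric.mem_nhds_iff.1 ht
  refine ⟨K, r / 2, K.2, by positivity, fun x y hx hy => ?_⟩
  have hmem : ∀ x, |x| ≤ r / 2 → x ∈ t := fun x hx => hrt (by simp; linarith)
  simpa [Real.dist_eq] using hK.dist_le_mul x (hmem x hx) y (hmem y hy)

theorem continuousOn_of_abs_sub_le {h : ℝ → ℝ} {K r : ℝ}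
    (hh : ∀ x y, |x| ≤ r → |y| ≤ r → |h x - h y| ≤ K * |x - y|) :
    ContinuousOn h {x | |x| ≤ r} := by
  refine (LipschitzOnWith.of_dist_le_mul (K := K.toNNReal) fun x hx y hy => ?_).continuousOn
  rw [Real.dist_eq, Real.dist_eq]
  exact (hh x y hx hy).trans
    (mul_le_mul_of_nonneg_right (Real.le_coe_toNNReal K) (abs_nonneg _))

theorem abs_scaled_integral_sub_le {h : ℝ → ℝ} {K r : ℝ} (n : ℕ) (hK : 0 ≤ K)
    (hh : ∀ x y, |x| ≤ r → |y| ≤ r → |h x - h y| ≤ K * |x - y|) {x y : ℝ} (hx : |x| ≤ r)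
    (hy : |y| ≤ r) :
    |(∫ s in (0:ℝ)..1, s ^ n * h (s * x)) - ∫ s in (0:ℝ)..1, s ^ n * h (s * y)| ≤
      K * |x - y| := by
  have hmem : ∀ x, |x| ≤ r → ∀ s ∈ Icc (0:ℝ) 1, |s * x| ≤ r := by
    intro x hx s hs
    rw [abs_mul, abs_of_nonneg hs.1]
    exact (mul_le_of_le_one_left (abs_nonneg x) hs.2).trans hx
  have hint : ∀ x, |x| ≤ r →
      IntervalIntegrable (fun s => s ^ n * h (s * x)) MeasureTheory.volume 0 1 := by
    intro x hx
    apply ContinuousOn.intervalIntegrable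
    rw [uIcc_of_le zero_le_one]
    refine (continuous_pow n).continuousOn.mul ?_
    exact (continuousOn_of_abs_sub_le hh).comp (continuous_mul_const x).continuousOn
      (fun s hs => hmem x hx s hs)
  rw [← intervalIntegral.integral_sub (hint x hx) (hint y hy)]
  have := intervalIntegral.norm_integral_le_of_norm_le_const (a := (0:ℝ)) (b := 1)
    (C := K * |x - y|) (f := fun s => s ^ n * h (s * x) - s ^ n * h (s * y)) (by
    intro s hs
    rw [uIoc_of_le zero_le_one] at hs
    have hs' : s ∈ Icc (0:ℝ) 1 := ⟨hs.1.le, hs.2⟩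
    rw [← mul_sub, norm_mul, norm_pow, Real.norm_eq_abs, Real.norm_eq_abs, abs_of_pos hs.1]
    have h1 := hh (s * x) (s * y) (hmem x hx s hs') (hmem y hy s hs')
    rw [← mul_sub, abs_mul, abs_of_pos hs.1] at h1
    have h2 : s ^ n ≤ 1 := pow_le_one₀ hs.1.le hs.2
    have h3 : K * (s * |x - y|) ≤ K * |x - y| :=
      mul_le_mul_of_nonneg_left (mul_le_of_le_one_left (abs_nonneg _) hs.2) hK
    calc s ^ n * |h (s * x) - h (s * y)| ≤ 1 * |h (s * x) - h (s * y)| := by gcongr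
      _ ≤ K * |x - y| := by linarith)
  simpa using this

/-- Near the origin the coefficients `f`, `g` are encoded by `B`, with `x² B(x) = ∫₀ˣ s f(s) ds`,
and `q`, with `g(x) = ω² x q(x) + x B(x)²`. -/
structure IsNormalForm (f g : ℝ → ℝ) (ω η : ℝ) (B q : ℝ → ℝ) : Prop where
  integral_eq : ∀ x, |x| < η → ∫ s in (0:ℝ)..x, s * f s = x ^ 2 * B x
  restoring_eq : ∀ x, |x| < η → g x = ω ^ 2 * (x * q x) + x * B x ^ 2
  deriv_mul_B : ∀ x, |x| < η → HasDerivAt (fun x => x * B x) (f x - B x) x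

theorem exists_nearHarmonic_isNormalForm {f g : ℝ → ℝ} (hf : ContDiffAt ℝ 1 f 0)
    (hg : ContDiffAt ℝ 2 g 0) (hf0 : f 0 = 0) (hg0 : g 0 = 0) (hg'0 : 0 < deriv g 0) {η₀ : ℝ}
    (hη₀ : 0 < η₀) :
    ∃ η L B q, 0 < η ∧ η ≤ η₀ ∧ NearHarmonic √(deriv g 0) L B q ∧
      IsNormalForm f g √(deriv g 0) η B q := by
  obtain ⟨K₁, r₁, hK₁, hr₁, hf1⟩ := exists_abs_sub_le_of_contDiffAt hf
  obtain ⟨K₂, r₂, hK₂, hr₂, hg1⟩ := exists_abs_sub_le_of_contDiffAt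
    (hg.derivWithin (m := 1) (by norm_num))
  obtain ⟨r₃, hr₃, hg2⟩ := Metric.eventually_nhds_iff.1 (hg.eventually (by norm_num))
  set ω := √(deriv g 0)
  have hω : 0 < ω := sqrt_pos.2 hg'0
  have hω2 : ω ^ 2 = deriv g 0 := sq_sqrt hg'0.le
  set K := K₁ + K₂ + 1
  have hK : 0 < K := by positivity
  obtain ⟨η, hη, hηle⟩ : ∃ η, 0 < η ∧ η ≤ η₀ ∧ η ≤ r₁ ∧ η ≤ r₂ ∧ η < r₃ ∧
      K * η ≤ 1 ∧ K * η ≤ ω / 4 ∧ K * η ≤ ω ^ 2 / 8 := by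
    have hev : ∀ {a : ℝ}, 0 < a → ∀ᶠ η in nhdsWithin (0:ℝ) (Ioi 0), η < a := fun ha =>
      Filter.Eventually.filter_mono nhdsWithin_le_nhds (Iio_mem_nhds ha)
    have hevK : ∀ {a : ℝ}, 0 < a → ∀ᶠ η in nhdsWithin (0:ℝ) (Ioi 0), K * η ≤ a := by
      intro a ha
      filter_upwards [hev (div_pos ha hK)] with η h
      rw [lt_div_iff₀ hK] at h
      linarith
    have hall : ∀ᶠ η in nhdsWithin (0:ℝ) (Ioi 0), 0 < η ∧ η ≤ η₀ ∧ η ≤ r₁ ∧ η ≤ r₂ ∧ η < r₃ ∧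
        K * η ≤ 1 ∧ K * η ≤ ω / 4 ∧ K * η ≤ ω ^ 2 / 8 := by
      filter_upwards [self_mem_nhdsWithin, hev hη₀, hev hr₁, hev hr₂, hev hr₃, hevK one_pos,
        hevK (a := ω / 4) (by positivity), hevK (a := ω ^ 2 / 8) (by positivity)] with
        η h0 h1 h2 h3 h4 h5 h6 h7
      exact ⟨h0, h1.le, h2.le, h3.le, h4, h5, h6, h7⟩
    exact hall.exists
  obtain ⟨hη0, hη1, hη2, hη3, hKη1, hKη2, hKη3⟩ := hηle
  set b : ℝ → ℝ := fun x => ∫ s in (0:ℝ)..1, s ^ 1 * f (s * x) with hb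
  set j : ℝ → ℝ := fun x => ∫ s in (0:ℝ)..1, s ^ 0 * deriv g (s * x) with hj
  set k : ℝ → ℝ := fun x => (j x - b x ^ 2) / ω ^ 2 with hk
  have hbl : ∀ x y, |x| ≤ η → |y| ≤ η → |b x - b y| ≤ K * |x - y| := fun x y hx hy =>
    (abs_scaled_integral_sub_le 1 hK₁ hf1 (hx.trans hη1) (hy.trans hη1)).trans
      (mul_le_mul_of_nonneg_right (by linarith) (abs_nonneg _))
  have hjl : ∀ x y, |x| ≤ η → |y| ≤ η → |j x - j y| ≤ K * |x - y| := fun x y hx hy =>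
    (abs_scaled_integral_sub_le 0 hK₂ hg1 (hx.trans hη2) (hy.trans hη2)).trans
      (mul_le_mul_of_nonneg_right (by linarith) (abs_nonneg _))
  have hb0 : b 0 = 0 := by simp [hb, hf0]
  have hj0 : j 0 = ω ^ 2 := by simp [hj, hω2]
  have hbη : ∀ x, |x| ≤ η → |b x| ≤ K * η := by
    intro x hx
    have := hbl x 0 hx (by simpa using hη.le)
    rw [hb0, sub_zero, sub_zero] at this
    exact this.trans (mul_le_mul_of_nonneg_left hx hK.le)
  have hkη : ∀ x, |x| ≤ η → |k x - 1| ≤ 1 / 4 := by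
    intro x hx
    have h1 := hjl x 0 hx (by simpa using hη.le)
    rw [hj0, sub_zero] at h1
    have h2 := h1.trans (mul_le_mul_of_nonneg_left hx hK.le)
    have h3 : |b x ^ 2| ≤ K * η := by
      rw [abs_pow, sq]
      have := hbη x hx
      nlinarith [abs_nonneg (b x)]
    have e : k x - 1 = ((j x - ω ^ 2) - b x ^ 2) / ω ^ 2 := by
      rw [hk]; field_simp; ring
    rw [e, abs_div, abs_of_pos (by positivity : 0 < ω ^ 2), div_le_iff₀ (by positivity)]
    linarith [abs_sub (j x - ω ^ 2) (b x ^ 2)]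
  have hkl : ∀ x y, |x| ≤ η → |y| ≤ η → |k x - k y| ≤ (3 * K / ω ^ 2) * |x - y| := by
    intro x y hx hy
    have e : k x - k y = ((j x - j y) - (b x + b y) * (b x - b y)) / ω ^ 2 := by
      rw [hk]; ring
    rw [e, abs_div, abs_of_pos (by positivity : 0 < ω ^ 2), div_mul_eq_mul_div]
    refine div_le_div_of_nonneg_right ((abs_sub _ _).trans ?_) (by positivity)
    rw [abs_mul]
    have h1 : |b x + b y| ≤ 2 := by
      linarith [abs_add_le (b x) (b y), hbη x hx, hbη y hy]
    have h2 := mul_le_mul h1 (hbl x y hx hy) (abs_nonneg _) zero_le_two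
    linarith [hjl x y hx hy]
  have hηη : -η ≤ η := by linarith
  set cl : ℝ → ℝ := fun x => (projIcc (-η) η hηη x : ℝ) with hcl
  have hclη : ∀ x, |cl x| ≤ η := fun x => abs_le.2 (projIcc (-η) η hηη x).2
  have hclid : ∀ x, |x| ≤ η → cl x = x := fun x hx => by
    rw [hcl]; simp only; rw [projIcc_of_mem hηη (abs_le.1 hx)]
  have hcll : ∀ x y, |cl x - cl y| ≤ |x - y| := by
    intro x y
    have := (LipschitzWith.projIcc hηη).dist_le_mul x y
    simpa [Subtype.dist_eq, Real.dist_eq] using this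
  have hcl0 : cl 0 = 0 := hclid 0 (by simpa using hη.le)
  have hk3 : 0 ≤ 3 * K / ω ^ 2 := by positivity
  have H : NearHarmonic ω (K + 3 * K / ω ^ 2) (fun x => b (cl x)) (fun x => k (cl x)) := by
    refine ⟨hω, by simp only [hcl0, hb0], fun x => (hbη _ (hclη x)).trans hKη2,
      fun x => hkη _ (hclη x), fun x y => ?_, fun x y => ?_⟩
    · refine (hbl _ _ (hclη x) (hclη y)).trans ?_
      exact mul_le_mul (by linarith) (hcll x y) (abs_nonneg _) (by positivity)
    · refine (hkl _ _ (hclη x) (hclη y)).trans ?_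
      exact mul_le_mul (by linarith) (hcll x y) (abs_nonneg _) (by positivity)
  have hbint : ∀ x, ∫ s in (0:ℝ)..x, s * f s = x ^ 2 * b x := by
    intro x
    have h1 := intervalIntegral.mul_integral_comp_mul_right (a := 0) (b := 1)
      (f := fun s => s * f s) x
    rw [zero_mul, one_mul] at h1
    rw [← h1, hb, sq, mul_assoc]
    congr 1
    rw [← intervalIntegral.integral_const_mul x]
    refine intervalIntegral.integral_congr fun s _ => ?_
    ring
  have hgint : ∀ x, |x| < η → g x = x * j x := by
    intro x hx
    have hsub : ∀ y ∈ uIcc 0 x, |y| ≤ |x| := by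
      intro y hy
      simpa using abs_sub_left_of_mem_uIcc hy
    have h1 := intervalIntegral.mul_integral_comp_mul_right (a := 0) (b := 1)
      (f := deriv g) x
    have h2 : ∫ y in (0:ℝ)..x, deriv g y = g x - g 0 := by
      refine intervalIntegral.integral_eq_sub_of_hasDerivAt (fun y hy => ?_) ?_
      · refine ((hg2 ?_).differentiableAt (by norm_num)).hasDerivAt
        rw [Real.dist_eq, sub_zero]
        linarith [hsub y hy]
      · refine ((continuousOn_of_abs_sub_le hg1).mono fun y hy => ?_).intervalIntegrable
        exact (hsub y hy).trans (hx.le.trans hη2)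
    rw [zero_mul, one_mul, h2, hg0, sub_zero] at h1
    simp only [hj, pow_zero, one_mul, h1]
  refine ⟨η, K + 3 * K / ω ^ 2, fun x => b (cl x), fun x => k (cl x), hη, hη0, H,
    fun x hx => ?_, fun x hx => ?_, fun x hx => ?_⟩
  · rw [hclid x hx.le, hbint]
  · rw [hclid x hx.le, hgint x hx, hk]
    field_simp
    ring
  · rcases eq_or_ne x 0 with rfl | hx0
    · have hB := H.continuous_B
      simp only [hcl0, hb0, hf0, sub_zero]
      rw [hasDerivAt_iff_tendsto_slope_zero]
      have h1 : Filter.Tendsto (fun t => b (cl t)) (nhdsWithin 0 {0}ᶜ) (nhds 0) := by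
        have := hB.tendsto 0
        simp only [hcl0, hb0] at this
        exact this.mono_left nhdsWithin_le_nhds
      refine h1.congr' ?_
      filter_upwards [self_mem_nhdsWithin] with t ht
      have ht0 : t ≠ 0 := ht
      simp only [zero_add, zero_mul, sub_zero, smul_eq_mul]
      field_simp
    · have hopen : IsOpen {x : ℝ | |x| < η} := isOpen_lt continuous_abs continuous_const
      have hfc : ContinuousOn (fun s => s * f s) {x | |x| ≤ r₁} :=
        continuousOn_id.mul (continuousOn_of_abs_sub_le hf1)
      have hfc' : ContinuousOn (fun s => s * f s) {x | |x| < η} :=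
        hfc.mono fun y (hy : |y| < η) => hy.le.trans hη1
      have hF : HasDerivAt (fun y => ∫ s in (0:ℝ)..y, s * f s) (x * f x) x := by
        refine intervalIntegral.integral_hasDerivAt_right ?_
          (hfc'.stronglyMeasurableAtFilter hopen x hx) (hfc'.continuousAt (hopen.mem_nhds hx))
        refine (hfc.mono fun y hy => ?_).intervalIntegrable
        have : |y| ≤ |x| := by simpa using abs_sub_left_of_mem_uIcc hy
        exact this.trans (hx.le.trans hη1)
      have h2 := hF.div (hasDerivAt_id x) hx0
      refine (h2.congr_of_eventuallyEq ?_).congr_deriv ?_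
      · filter_upwards [hopen.mem_nhds hx, isOpen_ne.mem_nhds hx0] with y hy hy0
        have hyη : |y| ≤ η := le_of_lt hy
        simp only [Pi.div_apply, id]
        rw [hclid y hyη, hbint, eq_div_iff hy0]
        ring
      · simp only [id]
        rw [hbint, hclid x hx.le]
        field_simp

theorem IsLienardSolution.solvesOn {f g u B q : ℝ → ℝ} {ω η : ℝ} (hu : IsLienardSolution f g u)
    (hω : 0 < ω) (N : IsNormalForm f g ω η B q) :
    SolvesOn ω B q u (fun t => (deriv u t + u t * B (u t)) / ω) {t | |u t| < η} := by
  intro t ht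
  have hud : HasDerivAt u (deriv u t) t :=
    (hu.1.differentiable (by norm_num) t).hasDerivAt
  have hu2 : HasDerivAt (deriv u) (deriv (deriv u) t) t := by
    have h1 : ContDiff ℝ 1 (deriv u) := ((contDiff_succ_iff_deriv (n := 1)).1 hu.1).2.2
    exact (h1.differentiable (by norm_num) t).hasDerivAt
  constructor
  · refine hud.congr_deriv ?_
    field_simp
    ring
  · have h2 := (hu2.add ((N.deriv_mul_B (u t) ht).comp t hud)).div_const ω
    refine h2.congr_deriv ?_
    have h3 := hu.2 t
    have h4 := N.restoring_eq (u t) ht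
    have h5 : deriv (deriv u) t = -(f (u t) * deriv u t) - g (u t) := by linarith
    rw [h5, h4]
    field_simp
    ring

/-- An orbit of the Liénard equation starting close to the origin, in polar coordinates. -/
theorem IsLienardSolution.exists_polar {f g u B q : ℝ → ℝ} {ω L η R c s : ℝ}
    (hu : IsLienardSolution f g u) (H : NearHarmonic ω L B q) (N : IsNormalForm f g ω η B q)
    (hR : 0 < R) (hR1 : R ≤ 1) (hRη : R < η) (hc : 0 < c) (hcR : 2 * c * exp (4 * π) ≤ R)
    (hu0 : u 0 = c) (hu'0 : deriv u 0 = 0)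
    (hs : IsLeast {p : ℝ | 0 < p ∧ ∀ t, u (t + p) = u t} s) :
    ∃ z φ τ l : ℝ → ℝ, IsPolar ω B q u z univ φ τ l ∧ (∀ ψ, l ψ ≤ 0) ∧ (∀ ψ, exp (l ψ) < η) ∧
      z 0 = c * (B c / ω) ∧ φ 0 = -arctan (B c / ω) ∧ ∀ ψ, τ (ψ + 2 * π) = τ ψ + s := by
  have hω := H.pos
  set β := B c / ω with hβ
  set z : ℝ → ℝ := fun t => (deriv u t + u t * B (u t)) / ω with hz
  have hz0 : z 0 = c * β := by simp only [hz, hu0, hu'0, hβ]; ring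
  have hux : Continuous u := hu.1.continuous
  have hzc : Continuous z :=
    ((hu.1.continuous_deriv (by norm_num)).add (hux.mul (H.continuous_B.comp hux))).div_const ω
  have hper : ∀ p, (∀ t, u (t + p) = u t) → ∀ t, z (t + p) = z t := by
    intro p hp t
    have h1 : deriv u (t + p) = deriv u t := by
      rw [← deriv_comp_add_const, show (fun x => u (x + p)) = u from funext hp]
    simp only [hz, h1, hp]
  have hβ1 : 0 < 1 + β ^ 2 := by positivity
  have hsq : 0 < √(1 + β ^ 2) := sqrt_pos.2 hβ1
  have hr₀ : 0 < c * √(1 + β ^ 2) := mul_pos hc hsq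
  have hx0 : u 0 = c * √(1 + β ^ 2) * cos (-arctan β) := by
    rw [hu0, cos_neg, cos_arctan]; field_simp
  have hz0' : z 0 = -(c * √(1 + β ^ 2) * sin (-arctan β)) := by
    rw [hz0, sin_neg, sin_arctan]; field_simp
  have hβ2 : |β| ≤ 1 / 4 := by
    rw [hβ, abs_div, abs_of_pos hω, div_le_iff₀ hω]
    linarith [H.B_bound c]
  have hsmall : (c * √(1 + β ^ 2)) ^ 2 * exp (4 * π) < R ^ 2 := by
    have h1 : β ^ 2 ≤ 1 := by rw [← sq_abs]; nlinarith [abs_nonneg β]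
    have h2 : (1:ℝ) ≤ exp (4 * π) := one_le_exp (by positivity)
    have h3 : (2 * c * exp (4 * π)) ^ 2 ≤ R ^ 2 := by gcongr
    rw [mul_pow, sq_sqrt hβ1.le]
    have h4 : 0 < c ^ 2 * exp (4 * π) := by positivity
    nlinarith [mul_nonneg h4.le (sub_nonneg.2 h1), mul_nonneg h4.le (sub_nonneg.2 h2)]
  have hxz := hu.solvesOn hω N
  have hmem : ∀ t, u t ^ 2 + z t ^ 2 ≤ R ^ 2 → |u t| < η := fun t ht =>
    (abs_le_of_sq_le_sq (by linarith [sq_nonneg (z t)] : u t ^ 2 ≤ R ^ 2) hR.le).trans_lt hRη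
  have hlt := H.energy_lt hux hzc hR hR1 (fun t ht => hxz t (hmem t ht)) hs.1.1 hs.1.2
    (hper s hs.1.2) hr₀ hx0 hz0' hsmall
  have hxz' : SolvesOn ω B q u z univ := fun t _ => hxz t (hmem t (hlt t).le)
  obtain ⟨φ, τ, l, hφ, P⟩ := H.exists_polar ordConnected_univ continuous_id (fun t => mem_univ t)
    (fun t _ => rfl) (mem_univ 0) hxz' hr₀ hx0 hz0'
  have hlR : ∀ ψ, exp (l ψ) < R := by
    intro ψ
    have h1 := P.energy (mem_univ (τ ψ))
    rw [P.right_inv] at h1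
    exact lt_of_pow_lt_pow_left₀ 2 hR.le (h1 ▸ hlt (τ ψ))
  have hl : ∀ ψ, l ψ ≤ 0 := fun ψ => exp_le_one_iff.1 ((hlR ψ).le.trans hR1)
  obtain ⟨s', hs', hleast⟩ := P.exists_isLeast_period H hl hs.1.1 hs.1.2 (hper s hs.1.2)
  have hss : s' = s := by
    refine hleast.unique ?_
    simpa only [and_iff_left_of_imp (hper _)] using hs
  exact ⟨z, φ, τ, l, P, hl, fun ψ => (hlR ψ).trans hRη, hz0, hφ, hss ▸ hs'⟩

/-- If `x ↦ x q(x)` is convex to the left of the origin and concave to its right, then `q`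
increases along segments towards the origin. -/
theorem le_apply_mul_of_convex_concave {C q : ℝ → ℝ} {a b η : ℝ} (ha : η ≤ -a) (hb : η ≤ b)
    (hCq : ∀ x, |x| < η → C x = x * q x)
    (hC : ∀ x ∈ Ioo a b, DifferentiableAt ℝ C x)
    (hC' : ∀ x ∈ Ioo a b, DifferentiableAt ℝ (deriv C) x)
    (hneg : ∀ x ∈ Ioo a (0:ℝ), 0 ≤ deriv (deriv C) x)
    (hpos : ∀ x ∈ Ioo (0:ℝ) b, deriv (deriv C) x ≤ 0) {x k : ℝ} (hx : |x| < η) (hk : 0 < k)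
    (hk1 : k ≤ 1) : q x ≤ q (k * x) := by
  have hη : 0 < η := (abs_nonneg x).trans_lt hx
  have hkx : |k * x| < η := by
    rw [abs_mul, abs_of_pos hk]
    exact (mul_le_of_le_one_left (abs_nonneg x) hk1).trans_lt hx
  have hC0 : C 0 = 0 := by simpa using hCq 0 (by simpa using hη)
  obtain ⟨hx1, hx2⟩ := abs_lt.1 hx
  rcases lt_trichotomy x 0 with h | rfl | h
  · have hsub : Ioc a 0 ⊆ Ioo a b := fun y hy => ⟨hy.1, hy.2.trans_lt (by linarith)⟩
    have hconv : ConvexOn ℝ (Ioc a 0) C := by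
      refine convexOn_of_deriv2_nonneg (convex_Ioc a 0)
        (fun y hy => (hC y (hsub hy)).continuousAt.continuousWithinAt) ?_ ?_ ?_ <;>
        rw [interior_Ioc] <;> intro y hy
      · exact (hC y (hsub ⟨hy.1, hy.2.le⟩)).differentiableWithinAt
      · exact (hC' y (hsub ⟨hy.1, hy.2.le⟩)).differentiableWithinAt
      · exact hneg y hy
    have h1 := hconv.2 (show x ∈ Ioc a 0 from ⟨by linarith, h.le⟩)
      (show (0:ℝ) ∈ Ioc a 0 from ⟨by linarith, le_rfl⟩) hk.le (sub_nonneg.2 hk1) (by ring)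
    simp only [smul_eq_mul, mul_zero, add_zero, hC0, hCq x hx, hCq _ hkx] at h1
    nlinarith [mul_neg_of_pos_of_neg hk h]
  · rw [mul_zero]
  · have hsub : Ico 0 b ⊆ Ioo a b := fun y hy => ⟨by linarith [hy.1], hy.2⟩
    have hconv : ConcaveOn ℝ (Ico 0 b) C := by
      refine concaveOn_of_deriv2_nonpos (convex_Ico 0 b)
        (fun y hy => (hC y (hsub hy)).continuousAt.continuousWithinAt) ?_ ?_ ?_ <;>
        rw [interior_Ico] <;> intro y hy
      · exact (hC y (hsub ⟨hy.1.le, hy.2⟩)).differentiableWithinAt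
      · exact (hC' y (hsub ⟨hy.1.le, hy.2⟩)).differentiableWithinAt
      · exact hpos y hy
    have h1 := hconv.2 (show x ∈ Ico 0 b from ⟨h.le, by linarith⟩)
      (show (0:ℝ) ∈ Ico 0 b from ⟨le_rfl, by linarith⟩) hk.le (sub_nonneg.2 hk1) (by ring)
    simp only [smul_eq_mul, mul_zero, add_zero, hC0, hCq x hx, hCq _ hkx] at h1
    nlinarith [mul_pos hk h]

/-- Suppose `g''(0) = f''(0) = 0` and the origin is a center of the Liénard equation with
period function `T`. Let `C(x) = g(x)/g'(0) − (1/(g'(0)x³))(∫₀ˣ s f(s) ds)²`, twice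
differentiable on an interval `J = (a₂,b₂) ∋ 0`. If `C'' > 0` on `J ∩ (−∞,0)` and `C'' < 0`
on `J ∩ (0,∞)`, then `T` is increasing near `0`; in the opposite case `T` is decreasing. -/
theorem lienard_period_monotone_of_C_convexity
    (a b : ℝ) (ha : a < 0) (hb : 0 < b) (f g : ℝ → ℝ)
    (hf : ContDiffOn ℝ 2 f (Icc a b)) (hg : ContDiffOn ℝ 3 g (Icc a b))
    (hf0 : f 0 = 0) (hg0 : g 0 = 0) (hg'0 : 0 < deriv g 0)
    (hg''0 : iteratedDeriv 2 g 0 = 0) (hf''0 : iteratedDeriv 2 f 0 = 0)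
    (δ : ℝ) (hδ : 0 < δ) (T : ℝ → ℝ)
    (hsol : ∀ c ∈ Ioo (0:ℝ) δ, ∃ u, IsLienardSolution f g u ∧ u 0 = c ∧ deriv u 0 = 0)
    (hcenter : ∀ c ∈ Ioo (0:ℝ) δ, ∀ u, IsLienardSolution f g u → u 0 = c → deriv u 0 = 0 →
      ∃ p > 0, ∀ t, u (t + p) = u t)
    (hT : ∀ c ∈ Ioo (0:ℝ) δ, ∀ u, IsLienardSolution f g u → u 0 = c → deriv u 0 = 0 →
      IsLeast {p : ℝ | 0 < p ∧ ∀ t, u (t + p) = u t} (T c))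
    (C : ℝ → ℝ)
    (hC : ∀ x : ℝ, x ≠ 0 →
      C x = g x / deriv g 0 - (1 / (deriv g 0 * x ^ 3)) * (∫ s in (0:ℝ)..x, s * f s) ^ 2)
    (hC0 : C 0 = 0)
    (a₂ b₂ : ℝ) (ha₂ : a₂ < 0) (hb₂ : 0 < b₂)
    (hCdiff : ∀ x ∈ Ioo a₂ b₂, DifferentiableAt ℝ C x)
    (hCdiff2 : ∀ x ∈ Ioo a₂ b₂, DifferentiableAt ℝ (deriv C) x) :
    ((∀ x ∈ Ioo a₂ (0:ℝ), 0 < deriv (deriv C) x) →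
      (∀ x ∈ Ioo (0:ℝ) b₂, deriv (deriv C) x < 0) →
      ∃ ε, 0 < ε ∧ ε ≤ δ ∧ MonotoneOn T (Ioo 0 ε)) ∧
    ((∀ x ∈ Ioo (0:ℝ) b₂, 0 < deriv (deriv C) x) →
      (∀ x ∈ Ioo a₂ (0:ℝ), deriv (deriv C) x < 0) →
      ∃ ε, 0 < ε ∧ ε ≤ δ ∧ AntitoneOn T (Ioo 0 ε)) := by
  have hcf : ContDiffAt ℝ 2 f 0 := hf.contDiffAt (Icc_mem_nhds ha hb)
  have hcg : ContDiffAt ℝ 3 g 0 := hg.contDiffAt (Icc_mem_nhds ha hb)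
  obtain ⟨η, L, B, q, hη, hη₀, H, N⟩ := exists_nearHarmonic_isNormalForm
    (hcf.of_le (by norm_num)) (hcg.of_le (by norm_num)) hf0 hg0 hg'0
    (lt_min one_pos (lt_min hb₂ (neg_pos.2 ha₂)))
  have hη1 : η ≤ 1 := hη₀.trans (min_le_left _ _)
  have hηb : η ≤ b₂ := hη₀.trans ((min_le_right _ _).trans (min_le_left _ _))
  have hηa : η ≤ -a₂ := hη₀.trans ((min_le_right _ _).trans (min_le_right _ _))
  have hω2 : √(deriv g 0) ^ 2 = deriv g 0 := sq_sqrt hg'0.le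
  set ω := √(deriv g 0)
  have hω := H.pos
  have hL : 0 ≤ L := by simpa using (abs_nonneg _).trans (H.B_lip 1 0)
  have hCq : ∀ x, |x| < η → C x = x * q x := by
    intro x hx
    rcases eq_or_ne x 0 with rfl | hx0
    · rw [hC0, zero_mul]
    · rw [hC x hx0, N.integral_eq x hx, N.restoring_eq x hx, ← hω2]
      field_simp
      ring
  obtain ⟨ε, hε, hεδ, hεη, hεL⟩ : ∃ ε, 0 < ε ∧ ε ≤ δ ∧ 2 * ε * exp (4 * π) ≤ η / 2 ∧
      2 * L * ε < ω := by
    refine ⟨min δ (min (η / (4 * exp (4 * π))) (ω / (2 * L + 1))), by positivity,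
      min_le_left _ _, ?_, ?_⟩
    · have h := (min_le_right δ _).trans
        (min_le_left (η / (4 * exp (4 * π))) (ω / (2 * L + 1)))
      rw [le_div_iff₀ (by positivity)] at h
      linarith
    · have h := (min_le_right δ _).trans
        (min_le_right (η / (4 * exp (4 * π))) (ω / (2 * L + 1)))
      rw [le_div_iff₀ (by positivity)] at h
      have h0 : 0 < min δ (min (η / (4 * exp (4 * π))) (ω / (2 * L + 1))) := by positivity
      linarith
  have horbit : ∀ c ∈ Ioo 0 ε, ∃ x z φ τ l : ℝ → ℝ, IsPolar ω B q x z univ φ τ l ∧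
      (∀ ψ, l ψ ≤ 0) ∧ (∀ ψ, exp (l ψ) < η) ∧ x 0 = c ∧ z 0 = c * (B c / ω) ∧
      φ 0 = -arctan (B c / ω) ∧ ∀ ψ, τ (ψ + 2 * π) = τ ψ + T c := by
    intro c hc
    have hcδ : c ∈ Ioo 0 δ := ⟨hc.1, hc.2.trans_le hεδ⟩
    obtain ⟨u, hu, hu0, hu'0⟩ := hsol c hcδ
    have hcR : 2 * c * exp (4 * π) ≤ η / 2 := by
      refine le_trans ?_ hεη
      have := hc.2.le
      gcongr
    obtain ⟨z, φ, τ, l, P, hl, hlη, hz, hφ, hτ⟩ := hu.exists_polar H N (by positivity)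
      (by linarith) (by linarith) hc.1 hcR hu0 hu'0 (hT c hcδ u hu hu0 hu'0)
    exact ⟨u, z, φ, τ, l, P, hl, hlη, hu0, hz, hφ, hτ⟩
  have hpair : ∀ c₁ ∈ Ioo 0 ε, ∀ c₂ ∈ Ioo 0 ε, c₁ < c₂ → ∃ ρ k : ℝ → ℝ,
      (∀ ψ, |ρ ψ| < η ∧ 0 < k ψ ∧ k ψ ≤ 1) ∧
      ((∀ ψ, q (ρ ψ) ≤ q (k ψ * ρ ψ)) → T c₁ ≤ T c₂) ∧
      ((∀ ψ, q (k ψ * ρ ψ) ≤ q (ρ ψ)) → T c₂ ≤ T c₁) := by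
    intro c₁ hc₁ c₂ hc₂ hc
    obtain ⟨x₁, z₁, φ₁, τ₁, l₁, P₁, hl₁, -, hx₁, hz₁, hφ₁, hτ₁⟩ := horbit c₁ hc₁
    obtain ⟨x₂, z₂, φ₂, τ₂, l₂, P₂, hl₂, hlη₂, hx₂, hz₂, hφ₂, hτ₂⟩ := horbit c₂ hc₂
    have hcL : 2 * L * c₂ < ω :=
      (mul_le_mul_of_nonneg_left hc₂.2.le (by positivity)).trans_lt hεL
    have hlt := H.logRad_lt P₁ P₂ hl₁ hl₂ hc₁.1 hc hcL hx₁ hz₁ hx₂ hz₂ hφ₁ hφ₂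
    have hk : ∀ ψ, exp (l₁ ψ) * cos ψ = exp (l₁ ψ - l₂ ψ) * (exp (l₂ ψ) * cos ψ) := fun ψ => by
      rw [← mul_assoc, ← exp_add, sub_add_cancel]
    refine ⟨fun ψ => exp (l₂ ψ) * cos ψ, fun ψ => exp (l₁ ψ - l₂ ψ), fun ψ => ⟨?_, exp_pos _,
      exp_le_one_iff.2 (by linarith [hlt ψ])⟩, fun h => P₁.period_le P₂ H hτ₁ hτ₂ fun ψ => ?_,
      fun h => P₂.period_le P₁ H hτ₂ hτ₁ fun ψ => ?_⟩
    · rw [abs_mul, abs_of_pos (exp_pos _)]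
      exact (mul_le_of_le_one_right (exp_pos _).le (abs_cos_le_one ψ)).trans_lt (hlη₂ ψ)
    all_goals
      have := h ψ
      rw [hk, angSpeed, angSpeed]
      gcongr
  constructor
  · intro hneg hpos
    refine ⟨ε, hε, hεδ, fun c₁ hc₁ c₂ hc₂ hc => ?_⟩
    rcases hc.eq_or_lt with rfl | hc
    · exact le_rfl
    obtain ⟨ρ, k, hρ, hT₁, -⟩ := hpair c₁ hc₁ c₂ hc₂ hc
    exact hT₁ fun ψ => le_apply_mul_of_convex_concave hηa hηb hCq hCdiff hCdiff2
      (fun x hx => (hneg x hx).le) (fun x hx => (hpos x hx).le) (hρ ψ).1 (hρ ψ).2.1 (hρ ψ).2.2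
  · intro hpos hneg
    refine ⟨ε, hε, hεδ, fun c₁ hc₁ c₂ hc₂ hc => ?_⟩
    rcases hc.eq_or_lt with rfl | hc
    · exact le_rfl
    obtain ⟨ρ, k, hρ, -, hT₂⟩ := hpair c₁ hc₁ c₂ hc₂ hc
    have hd : deriv (fun x => -C x) = fun x => -deriv C x := funext fun x => deriv.fun_neg
    have hd2 : ∀ x, deriv (deriv fun x => -C x) x = -deriv (deriv C) x := fun x => by
      rw [hd]
      exact deriv.fun_neg
    refine hT₂ fun ψ => neg_le_neg_iff.1 ?_
    exact le_apply_mul_of_convex_concave (C := fun x => -C x) (q := fun x => -q x) hηa hηb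
      (fun x hx => by rw [hCq x hx, mul_neg]) (fun x hx => (hCdiff x hx).fun_neg)
      (fun x hx => hd ▸ (hCdiff2 x hx).fun_neg)
      (fun x hx => by rw [hd2]; linarith [hneg x hx]) (fun x hx => by rw [hd2]; linarith [hpos x hx])
      (hρ ψ).1 (hρ ψ).2.1 (hρ ψ).2.2
end
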